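/- arXiv:2108.10664 — 7 statements merged into one kernel-verified Lean document; each statement's English description precedes it below -/
import Mathlib

section
/- There exist an integer N ≥ N₀+1, a symmetric positive definite matrix P ∈ ℝ^{(2N+1)×(2N+1)}, and reals α > 1, β > 0, γ > 0 such that the (2N+2)×(2N+2) block matrix Θ₁ = [[FᵀP + PF + 2δP + αγG, Pℒ],[ℒᵀP, −β]] is negative semidefinite and Θ₂ := 2γ(−(1−1/α)λ_{N+1} + q_c + δ) + β‖c‖²/λ_{N+1} ≤ 0. (Feasibility of the LMI constraints of Theorem 1, bounded observation case.) -/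
open Matrix

noncomputable section

/-- Negative semidefiniteness of a real matrix. -/
def Matrix.NegSemidef {ι : Type*} [Fintype ι] (M : Matrix ι ι ℝ) : Prop :=
  (-M).PosSemidef

/-- All eigenvalues of the complexification of `M` have real part `< r`. -/
def specLt {ι : Type*} [Fintype ι] [DecidableEq ι] (M : Matrix ι ι ℝ) (r : ℝ) : Prop :=
  ∀ μ : ℂ, (M.map (Complex.ofReal ·)).charpoly.IsRoot μ → μ.re < r

/-- `A₀ = diag(-λ₁ + q_c, …, -λ_{N₀} + q_c)`. -/
def A0 (N₀ : ℕ) (lam : ℕ → ℝ) (qc : ℝ) : Matrix (Fin N₀) (Fin N₀) ℝ :=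
  Matrix.diagonal fun i => -lam (i.1 + 1) + qc

/-- Column vector `(f 1, …, f N₀)ᵀ` (e.g. `B₀ₐ`, `B₀ᵦ`). -/
def colVec (N₀ : ℕ) (f : ℕ → ℝ) : Matrix (Fin N₀) (Fin 1) ℝ :=
  Matrix.of fun i _ => f (i.1 + 1)

/-- `A₁ = [[0, 0], [B₀ₐ, A₀]]`. -/
def A1 (N₀ : ℕ) (lam : ℕ → ℝ) (qc : ℝ) (a : ℕ → ℝ) :
    Matrix (Fin 1 ⊕ Fin N₀) (Fin 1 ⊕ Fin N₀) ℝ :=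
  Matrix.fromBlocks 0 0 (colVec N₀ a) (A0 N₀ lam qc)

/-- `B₁ = (1, b₁, …, b_{N₀})ᵀ`. -/
def B1 (N₀ : ℕ) (b : ℕ → ℝ) : Matrix (Fin 1 ⊕ Fin N₀) (Fin 1) ℝ :=
  Matrix.of (Sum.elim (fun _ _ => 1) (fun i _ => b (i.1 + 1)))

/-- Row `C₀ = (f 1, …, f N₀)`. -/
def C0 (N₀ : ℕ) (f : ℕ → ℝ) : Matrix (Fin 1) (Fin N₀) ℝ :=
  Matrix.of fun _ j => f (j.1 + 1)

/-- `A₂ = diag(-λ_{N₀+1} + q_c, …, -λ_N + q_c)`. -/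
def A2 (N₀ N : ℕ) (lam : ℕ → ℝ) (qc : ℝ) :
    Matrix (Fin (N - N₀)) (Fin (N - N₀)) ℝ :=
  Matrix.diagonal fun i => -lam (N₀ + 1 + i.1) + qc

/-- Column vector `(f (N₀+1), …, f N)ᵀ` (e.g. `B₂ₐ`, `B₂ᵦ`). -/
def colVec2 (N₀ N : ℕ) (f : ℕ → ℝ) : Matrix (Fin (N - N₀)) (Fin 1) ℝ :=
  Matrix.of fun i _ => f (N₀ + 1 + i.1)

/-- Row `C₁ = (c_{N₀+1}, …, c_N)` (bounded observation case). -/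
def C1 (N₀ N : ℕ) (c : ℕ → ℝ) : Matrix (Fin 1) (Fin (N - N₀)) ℝ :=
  Matrix.of fun _ j => c (N₀ + 1 + j.1)

/-- `L̃ = (0, Lᵀ)ᵀ`. -/
def Ltil (N₀ : ℕ) (L : Matrix (Fin N₀) (Fin 1) ℝ) :
    Matrix (Fin 1 ⊕ Fin N₀) (Fin 1) ℝ :=
  Matrix.of (Sum.elim (fun _ _ => 0) (fun i j => L i j))

/-- `[B₂ₐ 0]`. -/
def B2a0 (N₀ N : ℕ) (a : ℕ → ℝ) : Matrix (Fin (N - N₀)) (Fin 1 ⊕ Fin N₀) ℝ :=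
  Matrix.of fun i => Sum.elim (fun _ => a (N₀ + 1 + i.1)) (fun _ => 0)

/-- Closed-loop state index (total cardinality `2N+1` when `N₀ ≤ N`). -/
abbrev ιF (N₀ N : ℕ) := ((Fin 1 ⊕ Fin N₀) ⊕ Fin N₀) ⊕ (Fin (N - N₀) ⊕ Fin (N - N₀))

/-- The closed-loop matrix `F` of (23), parametrized by the rows `C₀` and `C₁`. -/
def Fmat (N₀ N : ℕ) (lam a b : ℕ → ℝ) (qc : ℝ)
    (K : Matrix (Fin 1) (Fin 1 ⊕ Fin N₀) ℝ) (L : Matrix (Fin N₀) (Fin 1) ℝ)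
    (C0m : Matrix (Fin 1) (Fin N₀) ℝ) (C1m : Matrix (Fin 1) (Fin (N - N₀)) ℝ) :
    Matrix (ιF N₀ N) (ιF N₀ N) ℝ :=
  Matrix.fromBlocks
    (Matrix.fromBlocks (A1 N₀ lam qc a + B1 N₀ b * K) (Ltil N₀ L * C0m)
      0 (A0 N₀ lam qc - L * C0m))
    (Matrix.fromBlocks 0 (Ltil N₀ L * C1m) 0 (-(L * C1m)))
    (Matrix.fromBlocks (colVec2 N₀ N b * K + B2a0 N₀ N a) 0 0 0)
    (Matrix.fromBlocks (A2 N₀ N lam qc) 0 0 (A2 N₀ N lam qc))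

/-- `ℒ = col(L̃, -L, 0, 0)`. -/
def Lcal (N₀ N : ℕ) (L : Matrix (Fin N₀) (Fin 1) ℝ) : Matrix (ιF N₀ N) (Fin 1) ℝ :=
  Matrix.of
    (Sum.elim (Sum.elim (fun i j => Ltil N₀ L i j) (fun i j => -L i j)) fun _ _ => 0)

/-- `E = (1, 0, …, 0)`. -/
def Erow (N₀ N : ℕ) : Matrix (Fin 1) (ιF N₀ N) ℝ :=
  Matrix.of fun _ =>
    Sum.elim (Sum.elim (Sum.elim (fun _ => 1) fun _ => 0) fun _ => 0) fun _ => 0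

/-- `K̃ = (K, 0, 0, 0)`. -/
def Ktil (N₀ N : ℕ) (K : Matrix (Fin 1) (Fin 1 ⊕ Fin N₀) ℝ) :
    Matrix (Fin 1) (ιF N₀ N) ℝ :=
  Matrix.of fun r => Sum.elim (Sum.elim (fun j => K r j) fun _ => 0) fun _ => 0

/-- `G = ‖a‖² EᵀE + ‖b‖² K̃ᵀK̃`. -/
def Gmat (N₀ N : ℕ) (na2 nb2 : ℝ) (K : Matrix (Fin 1) (Fin 1 ⊕ Fin N₀) ℝ) :
    Matrix (ιF N₀ N) (ιF N₀ N) ℝ :=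
  na2 • ((Erow N₀ N)ᵀ * Erow N₀ N) + nb2 • ((Ktil N₀ N K)ᵀ * Ktil N₀ N K)

/-- A positive definite real symmetric form on a complex vector space. -/
def IsPosForm {V : Type*} [AddCommGroup V] [Module ℂ V] (B : V → V → ℝ) : Prop :=
  (∀ x y z, B (x + y) z = B x z + B y z) ∧ (∀ (r : ℝ) x y, B ((r : ℂ) • x) y = r * B x y) ∧
    (∀ x y, B x y = B y x) ∧ ∀ x, x ≠ 0 → 0 < B x x

theorem IsPosForm.zero_left {V : Type*} [AddCommGroup V] [Module ℂ V] {B : V → V → ℝ}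
    (h : IsPosForm B) (y : V) : B 0 y = 0 := by
  have := h.2.1 0 0 y
  simpa using this

theorem IsPosForm.nonneg {V : Type*} [AddCommGroup V] [Module ℂ V] {B : V → V → ℝ}
    (h : IsPosForm B) (x : V) : 0 ≤ B x x := by
  by_cases hx : x = 0
  · rw [hx, h.zero_left]
  · exact (h.2.2.2 x hx).le

theorem IsPosForm.lin {V : Type*} [AddCommGroup V] [Module ℂ V] {B : V → V → ℝ}
    (h : IsPosForm B) (r s : ℝ) (x y : V) :
    B ((r : ℂ) • x + (s : ℂ) • y) ((r : ℂ) • x + (s : ℂ) • y)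
      = r ^ 2 * B x x + 2 * r * s * B x y + s ^ 2 * B y y := by
  obtain ⟨h1, h2, h3, -⟩ := h
  rw [h1, h2, h2, h3 x, h3 y, h1, h1, h2, h2, h2, h2, h3 y x]
  ring

theorem IsPosForm.young {V : Type*} [AddCommGroup V] [Module ℂ V] {B : V → V → ℝ}
    (h : IsPosForm B) {e : ℝ} (he : 0 < e) (x y : V) :
    B x y ≤ e * B x x + B y y / (4 * e) := by
  have h1 := h.nonneg (((2 * e : ℝ) : ℂ) • x + ((-1 : ℝ) : ℂ) • y)
  rw [h.lin] at h1
  have h2 : e * B x x + B y y / (4 * e) - B x y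
      = ((2 * e) ^ 2 * B x x + 2 * (2 * e) * (-1) * B x y + (-1) ^ 2 * B y y) / (4 * e) := by
    field_simp
    ring
  have h3 : 0 ≤ e * B x x + B y y / (4 * e) - B x y := by
    rw [h2]; positivity
  linarith

theorem lyap_aux (s : ℝ) (n : ℕ) : ∀ (V : Type) [AddCommGroup V] [Module ℂ V]
    [FiniteDimensional ℂ V], Module.finrank ℂ V = n → ∀ T : Module.End ℂ V,
    (∀ μ : ℂ, T.HasEigenvalue μ → μ.re < s) →
    ∃ B : V → V → ℝ, IsPosForm B ∧ ∃ ε : ℝ, 0 < ε ∧ ∀ x, B x (T x) ≤ (s - ε) * B x x := by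
  induction n using Nat.strong_induction_on with
  | _ n ih =>
  intro V _ _ _ hn T hT
  rcases subsingleton_or_nontrivial V with hV | hV
  · refine ⟨fun _ _ => 0, ⟨by simp, by simp, by simp, fun x hx => (hx (Subsingleton.elim _ _)).elim⟩,
      1, one_pos, by simp⟩
  obtain ⟨μ, hμ⟩ := Module.End.exists_eigenvalue (K := ℂ) (V := Module.Dual ℂ V) T.dualMap
  obtain ⟨φ, hφ⟩ := hμ.exists_hasEigenvector
  have hφT : ∀ x, φ (T x) = μ * φ x := by
    intro x
    have := congrArg (fun f : Module.Dual ℂ V => f x) hφ.apply_eq_smul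
    simpa using this
  have hφ0 : φ ≠ 0 := hφ.2
  obtain ⟨v0, hv0⟩ : ∃ v, φ v ≠ 0 := by
    by_contra hcon
    push Not at hcon
    exact hφ0 (LinearMap.ext hcon)
  obtain ⟨v, hv⟩ : ∃ v, φ v = 1 := ⟨(φ v0)⁻¹ • v0, by simp [hv0]⟩
  have hμs : μ.re < s := by
    apply hT
    by_contra hcon
    have hinj : Function.Injective (T - algebraMap ℂ (Module.End ℂ V) μ) := by
      rw [← LinearMap.ker_eq_bot]
      rw [Module.End.hasEigenvalue_iff, not_not, Module.End.eigenspace_def] at hcon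
      exact hcon
    have hsurj := LinearMap.surjective_of_injective hinj
    obtain ⟨y, hy⟩ := hsurj v
    have := congrArg φ hy
    simp [hφT, hv] at this
  have hWlt : Module.finrank ℂ (LinearMap.ker φ) < n := by
    rw [← hn]
    apply Submodule.finrank_lt
    intro h
    rw [LinearMap.ker_eq_top] at h
    exact hφ0 h
  have hinv : ∀ x ∈ LinearMap.ker φ, T x ∈ LinearMap.ker φ := by
    intro x hx
    rw [LinearMap.mem_ker] at hx ⊢
    rw [hφT, hx, mul_zero]
  obtain ⟨B, hB, ε, hε, hBT⟩ := ih _ hWlt (LinearMap.ker φ) rfl (T.restrict hinv) (by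
    intro ν hν
    apply hT
    obtain ⟨x, hx⟩ := hν.exists_hasEigenvector
    apply Module.End.hasEigenvalue_of_hasEigenvector (x := (x : V))
    refine ⟨?_, ?_⟩
    · rw [Module.End.mem_eigenspace_iff]
      have := congrArg Subtype.val hx.apply_eq_smul
      simpa using this
    · have := hx.2
      simpa using this)
  let π : V →ₗ[ℂ] LinearMap.ker φ :=
    LinearMap.codRestrict _ (LinearMap.id - φ.smulRight v) (by intro x; simp [hv])
  have hπ : ∀ x, ((π x : LinearMap.ker φ) : V) = x - φ x • v := fun x => rfl
  set w0 := π (T v) with hw0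
  have hπT : ∀ x, π (T x) = T.restrict hinv (π x) + φ x • w0 := by
    intro x
    apply Subtype.ext
    simp only [Submodule.coe_add, Submodule.coe_smul, LinearMap.coe_restrict_apply, hπ, hw0,
      map_sub, map_smul, hφT, hv]
    module
  set e := min ε (s - μ.re) / 2 with he
  have he0 : 0 < e := by
    have : 0 < min ε (s - μ.re) := lt_min hε (by linarith)
    linarith
  have he1 : 2 * e ≤ ε := by rw [he]; linarith [min_le_left ε (s - μ.re)]
  have he2 : 2 * e ≤ s - μ.re := by rw [he]; linarith [min_le_right ε (s - μ.re)]
  set b1 := B w0 w0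
  set b2 := B (Complex.I • w0) (Complex.I • w0)
  have hb1 : 0 ≤ b1 := hB.nonneg _
  have hb2 : 0 ≤ b2 := hB.nonneg _
  have hcross : ∀ t : ℂ, B (t • w0) (t • w0) ≤ 2 * (b1 + b2) * (t.re ^ 2 + t.im ^ 2) := by
    intro t
    have h1 : t • w0 = (t.re : ℂ) • w0 + (t.im : ℂ) • (Complex.I • w0) := by
      rw [smul_smul, ← add_smul, Complex.re_add_im]
    rw [h1, hB.lin]
    have h2 := hB.nonneg ((t.re : ℂ) • w0 + ((-t.im : ℝ) : ℂ) • (Complex.I • w0))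
    rw [hB.lin] at h2
    nlinarith [mul_nonneg hb1 (sq_nonneg t.im), mul_nonneg hb2 (sq_nonneg t.re)]
  set k := (b1 + b2) / (2 * e ^ 2) + 1 with hk
  have hk0 : 0 < k := by positivity
  have hke : 2 * (b1 + b2) / (4 * e) ≤ k * e := by
    have : k * e = 2 * (b1 + b2) / (4 * e) + e := by
      rw [hk]; field_simp; ring
    linarith
  refine ⟨fun x y => B (π x) (π y) + k * ((φ x).re * (φ y).re + (φ x).im * (φ y).im),
    ⟨?_, ?_, ?_, ?_⟩, e, he0, ?_⟩
  · intro x y z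
    simp only [map_add, hB.1, Complex.add_re, Complex.add_im]
    ring
  · intro r x y
    simp only [map_smul, hB.2.1, smul_eq_mul, Complex.re_ofReal_mul, Complex.im_ofReal_mul]
    ring
  · intro x y
    beta_reduce
    rw [hB.2.2.1]
    ring
  · intro x hx
    have h1 := hB.nonneg (π x)
    by_cases h2 : φ x = 0
    · have h3 : π x ≠ 0 := by
        intro h
        apply hx
        have := hπ x
        rw [h, h2] at this
        simpa using this.symm
      have := hB.2.2.2 _ h3
      simp only [h2, Complex.zero_re, Complex.zero_im]
      linarith
    · have h3 : 0 < Complex.normSq (φ x) := Complex.normSq_pos.mpr h2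
      rw [Complex.normSq_apply] at h3
      have := mul_pos hk0 h3
      linarith
  · intro x
    have h1 := hBT (π x)
    have h2 := hB.young he0 (π x) (φ x • w0)
    have h3 := hcross (φ x)
    have h0 := hB.nonneg (π x)
    simp only [hπT, hφT]
    rw [hB.2.2.1 (π x), hB.1, hB.2.2.1 _ (π x), hB.2.2.1 _ (π x)]
    simp only [Complex.mul_re, Complex.mul_im]
    set Q := B (π x) (π x)
    set p := (φ x).re
    set q := (φ x).im
    have h4 : B (φ x • w0) (φ x • w0) / (4 * e) ≤ k * e * (p ^ 2 + q ^ 2) := by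
      calc B (φ x • w0) (φ x • w0) / (4 * e) ≤ 2 * (b1 + b2) * (p ^ 2 + q ^ 2) / (4 * e) := by
            gcongr
        _ = 2 * (b1 + b2) / (4 * e) * (p ^ 2 + q ^ 2) := by ring
        _ ≤ _ := by gcongr
    have h5 : (2 * e) * (k * (p ^ 2 + q ^ 2)) ≤ (s - μ.re) * (k * (p ^ 2 + q ^ 2)) := by
      gcongr
    have h6 : 2 * e * Q ≤ ε * Q := by gcongr
    nlinarith

theorem lyap {ι : Type} [Fintype ι] [DecidableEq ι] (M : Matrix ι ι ℝ) (r : ℝ)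
    (h : specLt M r) :
    ∃ P : Matrix ι ι ℝ, P.PosDef ∧ ∃ ε : ℝ, 0 < ε ∧
      ∀ x : ι → ℝ, (P *ᵥ x) ⬝ᵥ (M *ᵥ x) ≤ (r - ε) * ((P *ᵥ x) ⬝ᵥ x) := by
  obtain ⟨B, hB, ε, hε, hBT⟩ := lyap_aux r _ (ι → ℂ) rfl
    (Matrix.toLin' (M.map (Complex.ofReal ·))) (by
      intro μ hμ
      apply h
      rw [Module.End.hasEigenvalue_iff_isRoot_charpoly] at hμ
      simpa using hμ)
  let c : (ι → ℝ) → (ι → ℂ) := fun x i => (x i : ℂ)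
  let E : ι → ι → ℂ := fun i => Pi.single i 1
  have hc : ∀ x, c x = ∑ i, (x i : ℂ) • E i := by
    intro x
    ext j
    simp [c, E, Finset.sum_apply, Pi.single_apply]
  have hsum : ∀ (x : ι → ℝ) (S : Finset ι) y, B (∑ i ∈ S, (x i : ℂ) • E i) y
      = ∑ i ∈ S, x i * B (E i) y := by
    intro x S y
    induction S using Finset.induction_on with
    | empty => simpa using hB.zero_left y
    | insert a S ha ih => rw [Finset.sum_insert ha, Finset.sum_insert ha, hB.1, hB.2.1, ih]
  let P : Matrix ι ι ℝ := Matrix.of fun i j => B (E i) (E j)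
  have key : ∀ x y, (P *ᵥ x) ⬝ᵥ y = B (c x) (c y) := by
    intro x y
    rw [hB.2.2.1, hc y, hsum]
    simp only [dotProduct, mulVec]
    refine Finset.sum_congr rfl fun i _ => ?_
    rw [mul_comm, hB.2.2.1, hc x, hsum]
    congr 1
    refine Finset.sum_congr rfl fun j _ => ?_
    simp only [P, Matrix.of_apply]
    rw [hB.2.2.1 (E i), mul_comm]
  refine ⟨P, ?_, ε, hε, ?_⟩
  · refine .of_dotProduct_mulVec_pos ?_ ?_
    · ext i j
      simp [P, hB.2.2.1 (E i)]
    · intro x hx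
      rw [star_trivial, dotProduct_comm, key]
      apply hB.2.2.2
      intro h0
      apply hx
      ext i
      simpa [c] using congrFun h0 i
  · intro x
    have h1 := hBT (c x)
    rw [key, key]
    have h2 : Matrix.toLin' (M.map (Complex.ofReal ·)) (c x) = c (M *ᵥ x) := by
      ext i
      simp [c, mulVec, dotProduct]
    rwa [h2] at h1

theorem posDef_young {ι : Type} [Fintype ι] [DecidableEq ι] {P : Matrix ι ι ℝ} (hP : P.PosDef)
    (v : ι → ℝ) : ∃ C : ℝ, 0 ≤ C ∧ ∀ x, (v ⬝ᵥ x) ^ 2 ≤ C * ((P *ᵥ x) ⬝ᵥ x) := by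
  have hu : IsUnit P.det := (Matrix.isUnit_iff_isUnit_det _).1 hP.isUnit
  set z := P⁻¹ *ᵥ v with hz
  have hPz : P *ᵥ z = v := by
    rw [hz, mulVec_mulVec, Matrix.mul_nonsing_inv _ hu, one_mulVec]
  have hnn : ∀ x, 0 ≤ (P *ᵥ x) ⬝ᵥ x := by
    intro x
    have := hP.posSemidef.dotProduct_mulVec_nonneg x
    rwa [star_trivial, dotProduct_comm] at this
  have hsym : Pᵀ = P := by
    have := hP.isHermitian
    simpa [Matrix.IsHermitian, conjTranspose_eq_transpose_of_trivial] using this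
  refine ⟨(P *ᵥ z) ⬝ᵥ z, hnn z, fun x => ?_⟩
  have h1 : (P *ᵥ x) ⬝ᵥ z = v ⬝ᵥ x := by
    rw [← hPz, dotProduct_comm, dotProduct_mulVec, ← mulVec_transpose, hsym]
  have h2 : ∀ t : ℝ, 0 ≤ ((P *ᵥ z) ⬝ᵥ z) * (t * t) + (2 * (v ⬝ᵥ x)) * t + (P *ᵥ x) ⬝ᵥ x := by
    intro t
    have := hnn (x + t • z)
    simp only [mulVec_add, mulVec_smul, add_dotProduct, dotProduct_add, smul_dotProduct,
      dotProduct_smul, smul_eq_mul, h1] at this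
    rw [hPz] at this ⊢
    linarith
  have h3 := discrim_le_zero h2
  rw [discrim] at h3
  linarith

theorem dot_self_nonneg {ι : Type} [Fintype ι] (x : ι → ℝ) : 0 ≤ x ⬝ᵥ x :=
  Finset.sum_nonneg fun i _ => mul_self_nonneg (x i)

theorem amgm {X Y Z : ℝ} (hY : 0 ≤ Y) (hZ : 0 ≤ Z) (h : X ^ 2 ≤ 4 * (Y * Z)) : X ≤ Y + Z := by
  apply le_of_sq_le_sq _ (by linarith)
  nlinarith [sq_nonneg (Y - Z)]

theorem theta_neg {ι : Type} [Fintype ι] [DecidableEq ι] (F P G : Matrix ι ι ℝ)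
    (l : Matrix ι (Fin 1) ℝ) (δ g β : ℝ) (hP : Pᵀ = P) (hG : Gᵀ = G)
    (h : ∀ (x : ι → ℝ) (u : ℝ), 2 * ((P *ᵥ x) ⬝ᵥ (F *ᵥ x)) + 2 * δ * ((P *ᵥ x) ⬝ᵥ x)
      + g * ((G *ᵥ x) ⬝ᵥ x) + 2 * u * ((P *ᵥ x) ⬝ᵥ (fun i => l i 0)) - β * u ^ 2 ≤ 0) :
    (Matrix.fromBlocks (Fᵀ * P + P * F + (2 * δ) • P + g • G) (P * l) (lᵀ * P)
      ((-β) • (1 : Matrix (Fin 1) (Fin 1) ℝ))).NegSemidef := by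
  refine .of_dotProduct_mulVec_nonneg ?_ ?_
  · rw [Matrix.IsHermitian, conjTranspose_eq_transpose_of_trivial, transpose_neg,
      fromBlocks_transpose]
    simp only [transpose_add, transpose_mul, transpose_smul, hP, hG, transpose_transpose,
      transpose_one]
    rw [add_comm (P * F)]
  · intro v
    obtain ⟨x, y, rfl⟩ : ∃ (x : ι → ℝ) (y : Fin 1 → ℝ), v = Sum.elim x y :=
      ⟨v ∘ Sum.inl, v ∘ Sum.inr, by simp⟩
    have hy : y = fun _ => y 0 := by ext i; rw [Subsingleton.elim i 0]
    have h1 := h x (y 0)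
    have hl : l *ᵥ y = y 0 • (fun i => l i 0) := by
      ext i; simp [mulVec, dotProduct, mul_comm]
    have hl2 : ∀ w, y ⬝ᵥ (lᵀ *ᵥ w) = y 0 * (w ⬝ᵥ (fun i => l i 0)) := by
      intro w
      simp [mulVec, dotProduct, mul_comm]
    have hPx : ∀ w, x ⬝ᵥ (P *ᵥ w) = (P *ᵥ x) ⬝ᵥ w := by
      intro w
      rw [dotProduct_mulVec, ← mulVec_transpose, hP]
    have hF : x ⬝ᵥ (Fᵀ *ᵥ (P *ᵥ x)) = (P *ᵥ x) ⬝ᵥ (F *ᵥ x) := by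
      rw [mulVec_transpose, dotProduct_comm, dotProduct_mulVec]
    have hyy : y ⬝ᵥ y = y 0 ^ 2 := by simp [dotProduct, sq]
    rw [star_trivial, neg_mulVec, dotProduct_neg, fromBlocks_mulVec]
    simp only [Sum.elim_comp_inl, Sum.elim_comp_inr, sumElim_dotProduct_sumElim, add_mulVec,
      dotProduct_add, smul_mulVec, dotProduct_smul, one_mulVec, ← mulVec_mulVec, hl, hl2, hPx, hF,
      smul_eq_mul, hyy, dotProduct_comm x (G *ᵥ x)]
    linarith

theorem cs_tail (N₀ m : ℕ) (f : ℕ → ℝ) (hf : Summable fun n : ℕ => f (n + 1) ^ 2)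
    (w : Fin m → ℝ) :
    ((fun i : Fin m => f (N₀ + 1 + i.1)) ⬝ᵥ w) ^ 2 ≤ (∑' n : ℕ, f (n + 1) ^ 2) * (w ⬝ᵥ w) := by
  have h1 : ∑ i : Fin m, f (N₀ + 1 + i.1) ^ 2 ≤ ∑' n : ℕ, f (n + 1) ^ 2 := by
    let e : Fin m ↪ ℕ := ⟨fun i => N₀ + i.1, fun i j h => by
      apply Fin.ext; simpa using h⟩
    have := hf.sum_le_tsum (Finset.univ.map e) (fun i _ => sq_nonneg _)
    rw [Finset.sum_map] at this
    refine le_trans (le_of_eq ?_) this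
    refine Finset.sum_congr rfl fun i _ => ?_
    have h : N₀ + 1 + i.1 = e i + 1 := by
      change N₀ + 1 + i.1 = N₀ + i.1 + 1
      omega
    rw [h]
  have h2 := Finset.sum_mul_sq_le_sq_mul_sq Finset.univ (fun i : Fin m => f (N₀ + 1 + i.1)) w
  have h3 : w ⬝ᵥ w = ∑ i, w i ^ 2 := by simp [dotProduct, sq]
  rw [h3]
  refine h2.trans ?_
  gcongr

set_option maxHeartbeats 1000000 in
theorem scal {ε1 ε2 η na nb nc κ0 κ1 k0 k1 k2 : ℝ} (hε1 : 0 < ε1) (hε2 : 0 < ε2) (hη : 0 < η)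
    (hna : 0 ≤ na) (hnb : 0 ≤ nb) (hnc : 0 ≤ nc) (hκ0 : 0 ≤ κ0) (hκ1 : 0 ≤ κ1)
    (hk0 : 0 ≤ k0) (hk1 : 0 ≤ k1) (hk2 : 0 ≤ k2) :
    ∃ p2 p3 p4 β γ : ℝ, 0 < p2 ∧ 0 < p3 ∧ 0 < p4 ∧ 0 < β ∧ 0 < γ ∧
      ∀ qx qy zz ww f cy cw u h e0 e1 bz az : ℝ, 0 ≤ qx → 0 ≤ qy → 0 ≤ zz → 0 ≤ ww →
        f ^ 2 ≤ k1 * qx → cy ^ 2 ≤ k0 * qy → cw ^ 2 ≤ nc * ww → h ^ 2 ≤ k2 * qy →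
        e0 ^ 2 ≤ κ0 * qx → e1 ^ 2 ≤ κ1 * qx → bz ^ 2 ≤ nb * zz → az ^ 2 ≤ na * zz →
        (-ε1 * qx + f * (cy + (cw + u))) + p2 * (-ε2 * qy - h * (cw + u))
          + p3 * (-η * zz + (e1 * bz + e0 * az)) + p4 * (-η * ww)
          + γ * (na * e0 ^ 2 + nb * e1 ^ 2) - β * u ^ 2 ≤ 0 := by
  set g := na * κ0 + nb * κ1 with hg
  have hg0 : 0 ≤ g := by positivity
  set p2 := 4 * k0 * (k1 + 1) / (ε1 * ε2) + 1 with hp2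
  have hp20 : 0 < p2 := by positivity
  set k3 := 2 * (k1 + 1) / ε1 + p2 * (k2 + 1) / (2 * ε2) with hk3
  have hk30 : 0 < k3 := by positivity
  refine ⟨p2, η * ε1 / (2 * (g + 1)), (2 * k3 * nc + 1) / η, 2 * k3, ε1 / (4 * (g + 1)), hp20,
    by positivity, by positivity, by positivity, by positivity, ?_⟩
  intro qx qy zz ww f cy cw u h e0 e1 bz az hqx hqy hzz hww hf hcy hcw hh he0 he1 hbz haz
  set s := cw + u with hs
  have hE : na * e0 ^ 2 + nb * e1 ^ 2 ≤ g * qx := by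
    have h1 := mul_le_mul_of_nonneg_left he0 hna
    have h2 := mul_le_mul_of_nonneg_left he1 hnb
    rw [hg]; linarith
  have hs2 : s ^ 2 ≤ 2 * nc * ww + 2 * u ^ 2 := by
    rw [hs]; nlinarith [sq_nonneg (cw - u)]
  have ht2 : (cy + s) ^ 2 ≤ 2 * (k0 * qy) + 2 * s ^ 2 := by
    nlinarith [sq_nonneg (cy - s)]
  -- the `f` term
  have T1 : f * (cy + s) ≤ ε1 / 4 * qx + (k1 + 1) / ε1 * (cy + s) ^ 2 := by
    apply amgm (by positivity) (by positivity)
    have : 4 * (ε1 / 4 * qx * ((k1 + 1) / ε1 * (cy + s) ^ 2)) = (k1 + 1) * qx * (cy + s) ^ 2 := by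
      field_simp
    rw [this, mul_pow]
    gcongr
    linarith
  have T1' : (k1 + 1) / ε1 * (cy + s) ^ 2 ≤ p2 * ε2 / 2 * qy + 2 * (k1 + 1) / ε1 * s ^ 2 := by
    calc (k1 + 1) / ε1 * (cy + s) ^ 2 ≤ (k1 + 1) / ε1 * (2 * (k0 * qy) + 2 * s ^ 2) := by gcongr
      _ = (4 * k0 * (k1 + 1) / (ε1 * ε2)) * ε2 / 2 * qy + 2 * (k1 + 1) / ε1 * s ^ 2 := by
        field_simp
        ring
      _ ≤ _ := by
        gcongr
        rw [hp2]; linarith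
  -- the `h` term
  have T2 : -h * s ≤ ε2 / 2 * qy + (k2 + 1) / (2 * ε2) * s ^ 2 := by
    apply amgm (by positivity) (by positivity)
    have : 4 * (ε2 / 2 * qy * ((k2 + 1) / (2 * ε2) * s ^ 2)) = (k2 + 1) * qy * s ^ 2 := by
      field_simp
      ring
    rw [this, mul_pow, neg_sq]
    gcongr
    linarith
  have T2' := mul_le_mul_of_nonneg_left T2 hp20.le
  -- the `z` terms
  have T3 : e1 * bz ≤ η / 2 * zz + nb * e1 ^ 2 / (2 * η) := by
    apply amgm (by positivity) (by positivity)
    have : 4 * (η / 2 * zz * (nb * e1 ^ 2 / (2 * η))) = e1 ^ 2 * (nb * zz) := by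
      field_simp
      ring
    rw [this, mul_pow]
    gcongr
  have T4 : e0 * az ≤ η / 2 * zz + na * e0 ^ 2 / (2 * η) := by
    apply amgm (by positivity) (by positivity)
    have : 4 * (η / 2 * zz * (na * e0 ^ 2 / (2 * η))) = e0 ^ 2 * (na * zz) := by
      field_simp
      ring
    rw [this, mul_pow]
    gcongr
  have T5 : η * ε1 / (2 * (g + 1)) * (-η * zz + (e1 * bz + e0 * az)) ≤ ε1 / 4 * qx := by
    calc η * ε1 / (2 * (g + 1)) * (-η * zz + (e1 * bz + e0 * az))
        ≤ η * ε1 / (2 * (g + 1)) * ((na * e0 ^ 2 + nb * e1 ^ 2) / (2 * η)) := by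
          gcongr
          rw [add_div]; linarith
      _ ≤ η * ε1 / (2 * (g + 1)) * (((g + 1) * qx) / (2 * η)) := by
          gcongr
          linarith
      _ = ε1 / 4 * qx := by field_simp; ring
  have T6 : ε1 / (4 * (g + 1)) * (na * e0 ^ 2 + nb * e1 ^ 2) ≤ ε1 / 4 * qx := by
    calc ε1 / (4 * (g + 1)) * (na * e0 ^ 2 + nb * e1 ^ 2)
        ≤ ε1 / (4 * (g + 1)) * ((g + 1) * qx) := by
          gcongr
          linarith
      _ = ε1 / 4 * qx := by field_simp
  have T7 : (2 * k3 * nc + 1) / η * (-η * ww) = -(2 * k3 * nc * ww) - ww := by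
    field_simp
    ring
  have T8 : k3 * s ^ 2 ≤ 2 * k3 * nc * ww + 2 * k3 * u ^ 2 := by
    have := mul_le_mul_of_nonneg_left hs2 hk30.le
    linarith
  have T9 : k3 * s ^ 2 = 2 * (k1 + 1) / ε1 * s ^ 2 + p2 * ((k2 + 1) / (2 * ε2) * s ^ 2) := by
    rw [hk3]; ring
  have T10 : 0 ≤ ε1 * qx := by positivity
  rw [T7]
  clear_value g p2 k3 s
  have T11 : p2 * (-ε2 * qy - h * s) = -(p2 * ε2 * qy) + p2 * (-h * s) := by ring
  have T12 : p2 * (ε2 / 2 * qy + (k2 + 1) / (2 * ε2) * s ^ 2)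
      = p2 * ε2 / 2 * qy + p2 * ((k2 + 1) / (2 * ε2) * s ^ 2) := by ring
  rw [T12] at T2'
  rw [T11]
  linarith

/-- Feasibility of the LMI constraints of Theorem 1 (bounded
observation operator): there exist `N ≥ N₀+1`, a symmetric positive definite `P`,
and reals `α > 1`, `β, γ > 0` such that `Θ₁ ⪯ 0` and `Θ₂ ≤ 0`. -/
theorem lmi_feasibility_bounded_observation
    (N₀ : ℕ) (hN₀ : 1 ≤ N₀) (δ qc pstar : ℝ) (hδ : 0 < δ) (hpstar : 0 < pstar)
    (lam a b c : ℕ → ℝ)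
    (hmono : ∀ n, 1 ≤ n → lam n ≤ lam (n + 1))
    (hnonneg : ∀ n, 1 ≤ n → 0 ≤ lam n)
    (hlow : ∀ n : ℕ, 1 ≤ n → Real.pi ^ 2 * ((n : ℝ) - 1) ^ 2 * pstar ≤ lam n)
    (hgap : ∀ n, N₀ + 1 ≤ n → -lam n + qc < -δ)
    (ha : Summable fun n : ℕ => a (n + 1) ^ 2)
    (hb : Summable fun n : ℕ => b (n + 1) ^ 2)
    (hc : Summable fun n : ℕ => c (n + 1) ^ 2)
    (K : Matrix (Fin 1) (Fin 1 ⊕ Fin N₀) ℝ) (L : Matrix (Fin N₀) (Fin 1) ℝ)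
    (hK : specLt (A1 N₀ lam qc a + B1 N₀ b * K) (-δ))
    (hL : specLt (A0 N₀ lam qc - L * C0 N₀ c) (-δ)) :
    ∃ N : ℕ, N₀ + 1 ≤ N ∧
      ∃ P : Matrix (ιF N₀ N) (ιF N₀ N) ℝ, P.IsSymm ∧ P.PosDef ∧
        ∃ α β γ : ℝ, 1 < α ∧ 0 < β ∧ 0 < γ ∧
          (Matrix.fromBlocks
            ((Fmat N₀ N lam a b qc K L (C0 N₀ c) (C1 N₀ N c))ᵀ * P +
              P * Fmat N₀ N lam a b qc K L (C0 N₀ c) (C1 N₀ N c) + (2 * δ) • P +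
              (α * γ) • Gmat N₀ N (∑' n : ℕ, a (n + 1) ^ 2) (∑' n : ℕ, b (n + 1) ^ 2) K)
            (P * Lcal N₀ N L) ((Lcal N₀ N L)ᵀ * P)
            ((-β) • (1 : Matrix (Fin 1) (Fin 1) ℝ))).NegSemidef ∧
          2 * γ * (-(1 - 1 / α) * lam (N + 1) + qc + δ)
            + β * (∑' n : ℕ, c (n + 1) ^ 2) / lam (N + 1) ≤ 0 := by
  obtain ⟨P1, hP1, ε1, hε1, hl1⟩ := lyap _ _ hK
  obtain ⟨P2, hP2, ε2, hε2, hl2⟩ := lyap _ _ hL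
  set na := ∑' n : ℕ, a (n + 1) ^ 2 with hna
  set nb := ∑' n : ℕ, b (n + 1) ^ 2 with hnb
  set nc := ∑' n : ℕ, c (n + 1) ^ 2 with hnc
  have hna0 : 0 ≤ na := tsum_nonneg fun _ => sq_nonneg _
  have hnb0 : 0 ≤ nb := tsum_nonneg fun _ => sq_nonneg _
  have hnc0 : 0 ≤ nc := tsum_nonneg fun _ => sq_nonneg _
  have hs1 : P1ᵀ = P1 := by
    simpa [Matrix.IsHermitian, conjTranspose_eq_transpose_of_trivial] using hP1.isHermitian
  have hs2 : P2ᵀ = P2 := by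
    simpa [Matrix.IsHermitian, conjTranspose_eq_transpose_of_trivial] using hP2.isHermitian
  set η := lam (N₀ + 1) - qc - δ with hηdef
  have hη : 0 < η := by
    have := hgap (N₀ + 1) le_rfl
    rw [hηdef]; linarith
  have hlamη : ∀ i : ℕ, η ≤ lam (N₀ + 1 + i) - qc - δ := by
    intro i
    induction i with
    | zero => simp [hηdef]
    | succ i ih =>
      have := hmono (N₀ + 1 + i) (by omega)
      rw [← add_assoc]
      linarith
  obtain ⟨k1, hk1, hf⟩ := posDef_young hP1 (P1 *ᵥ (fun i => Ltil N₀ L i 0))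
  obtain ⟨k2, hk2, hh⟩ := posDef_young hP2 (P2 *ᵥ (fun i => L i 0))
  obtain ⟨k0, hk0, hcy⟩ := posDef_young hP2 (fun j => C0 N₀ c 0 j)
  obtain ⟨κ1, hκ1, he1⟩ := posDef_young hP1 (fun j => K 0 j)
  obtain ⟨κ0, hκ0, he0⟩ := posDef_young hP1 (Pi.single (Sum.inl 0) 1)
  obtain ⟨p2, p3, p4, β, γ, hp2, hp3, hp4, hβ, hγ, hscal⟩ :=
    scal hε1 hε2 hη hna0 hnb0 hnc0 hκ0 hκ1 hk0 hk1 hk2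
  obtain ⟨N1, hN1⟩ := exists_nat_ge ((1 + 2 * |qc + δ| + 2 * β * nc / γ) / pstar)
  set N := max (N₀ + 1) N1 with hN
  have hNN : N₀ + 1 ≤ N := le_max_left _ _
  have hlamN : 1 + 2 * |qc + δ| + 2 * β * nc / γ ≤ lam (N + 1) := by
    have h1 := hlow (N + 1) (by omega)
    have h2 : ((1 + 2 * |qc + δ| + 2 * β * nc / γ) / pstar) ≤ (N : ℝ) :=
      hN1.trans (by exact_mod_cast le_max_right _ _)
    rw [div_le_iff₀ hpstar] at h2
    have h3 : (1 : ℝ) ≤ N := by exact_mod_cast (by omega : 1 ≤ N)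
    have h4 : (1 : ℝ) ≤ Real.pi ^ 2 := by nlinarith [Real.pi_gt_three]
    have h5 : (N : ℝ) * pstar ≤ Real.pi ^ 2 * (N : ℝ) ^ 2 * pstar := by
      gcongr
      nlinarith
    push_cast at h1
    rw [add_sub_cancel_right] at h1
    linarith
  have hnn1 : ∀ x, 0 ≤ (P1 *ᵥ x) ⬝ᵥ x := by
    intro x
    have := hP1.posSemidef.dotProduct_mulVec_nonneg x
    rwa [star_trivial, dotProduct_comm] at this
  have hnn2 : ∀ x, 0 ≤ (P2 *ᵥ x) ⬝ᵥ x := by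
    intro x
    have := hP2.posSemidef.dotProduct_mulVec_nonneg x
    rwa [star_trivial, dotProduct_comm] at this
  let P : Matrix (ιF N₀ N) (ιF N₀ N) ℝ :=
    Matrix.fromBlocks (Matrix.fromBlocks P1 0 0 (p2 • P2)) 0 0
      (Matrix.fromBlocks (p3 • 1) 0 0 (p4 • 1))
  have hPs : Pᵀ = P := by
    simp [P, fromBlocks_transpose, hs1, hs2]
  have hsplit : ∀ v : ιF N₀ N → ℝ, ∃ (x : Fin 1 ⊕ Fin N₀ → ℝ) (y : Fin N₀ → ℝ)
      (z w : Fin (N - N₀) → ℝ), v = Sum.elim (Sum.elim x y) (Sum.elim z w) := by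
    intro v
    refine ⟨fun i => v (.inl (.inl i)), fun i => v (.inl (.inr i)), fun i => v (.inr (.inl i)),
      fun i => v (.inr (.inr i)), ?_⟩
    ext i
    rcases i with ((i | i) | (i | i)) <;> rfl
  have hPv : ∀ (x : Fin 1 ⊕ Fin N₀ → ℝ) (y : Fin N₀ → ℝ) (z w : Fin (N - N₀) → ℝ),
      P *ᵥ (Sum.elim (Sum.elim x y) (Sum.elim z w)) =
        Sum.elim (Sum.elim (P1 *ᵥ x) (p2 • (P2 *ᵥ y))) (Sum.elim (p3 • z) (p4 • w)) := by
    intro x y z w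
    simp [P, fromBlocks_mulVec, smul_mulVec]
  refine ⟨N, hNN, P, hPs, ?_, 2, 2 * β, γ, one_lt_two, by positivity, hγ, ?_, ?_⟩
  · refine .of_dotProduct_mulVec_pos ?_ ?_
    · rw [Matrix.IsHermitian, conjTranspose_eq_transpose_of_trivial, hPs]
    · intro v hv
      obtain ⟨x, y, z, w, rfl⟩ := hsplit v
      rw [star_trivial, dotProduct_comm, hPv]
      simp only [sumElim_dotProduct_sumElim, smul_dotProduct, smul_eq_mul]
      have h1 := hnn1 x
      have h2 := mul_nonneg hp2.le (hnn2 y)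
      have h3 : 0 ≤ p3 * (z ⬝ᵥ z) := mul_nonneg hp3.le (dot_self_nonneg z)
      have h4 : 0 ≤ p4 * (w ⬝ᵥ w) := mul_nonneg hp4.le (dot_self_nonneg w)
      by_contra hcon
      push Not at hcon
      have hx : x = 0 := by
        by_contra hx
        have := hP1.dotProduct_mulVec_pos hx
        rw [star_trivial, dotProduct_comm] at this
        linarith
      have hy : y = 0 := by
        by_contra hy
        have := hP2.dotProduct_mulVec_pos hy
        rw [star_trivial, dotProduct_comm] at this
        have := mul_pos hp2 this
        linarith
      have hz : z = 0 := by
        rw [← dotProduct_self_eq_zero]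
        have : p3 * (z ⬝ᵥ z) = 0 := by linarith
        exact (mul_eq_zero.1 this).resolve_left hp3.ne'
      have hw : w = 0 := by
        rw [← dotProduct_self_eq_zero]
        have : p4 * (w ⬝ᵥ w) = 0 := by linarith
        exact (mul_eq_zero.1 this).resolve_left hp4.ne'
      apply hv
      subst hx hy hz hw
      ext i
      rcases i with ((i | i) | (i | i)) <;> rfl
  · apply theta_neg _ _ _ _ _ _ _ hPs
    · simp [Gmat, transpose_add, transpose_smul, transpose_mul]
    intro v u
    obtain ⟨x, y, z, w, rfl⟩ := hsplit v
    have hFv : Fmat N₀ N lam a b qc K L (C0 N₀ c) (C1 N₀ N c) *ᵥ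
        (Sum.elim (Sum.elim x y) (Sum.elim z w)) =
        Sum.elim (Sum.elim
          ((A1 N₀ lam qc a + B1 N₀ b * K) *ᵥ x
            + ((fun j => C0 N₀ c 0 j) ⬝ᵥ y + (fun i : Fin (N - N₀) => c (N₀ + 1 + i.1)) ⬝ᵥ w) •
              (fun i => Ltil N₀ L i 0))
          ((A0 N₀ lam qc - L * C0 N₀ c) *ᵥ y
            - ((fun i : Fin (N - N₀) => c (N₀ + 1 + i.1)) ⬝ᵥ w) • (fun i => L i 0)))
        (Sum.elim
          (((fun j => K 0 j) ⬝ᵥ x) • (fun i : Fin (N - N₀) => b (N₀ + 1 + i.1))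
            + (Pi.single (Sum.inl 0) 1 ⬝ᵥ x) • (fun i : Fin (N - N₀) => a (N₀ + 1 + i.1))
            + A2 N₀ N lam qc *ᵥ z)
          (A2 N₀ N lam qc *ᵥ w)) := by
      have hone : ∀ {ι κ : Type} [Fintype κ] (l : Matrix ι (Fin 1) ℝ) (r : Matrix (Fin 1) κ ℝ)
          (t : κ → ℝ), (l * r) *ᵥ t = ((fun j => r 0 j) ⬝ᵥ t) • (fun i => l i 0) := by
        intro ι κ _ l r t
        rw [← mulVec_mulVec]
        ext i
        simp [mulVec, dotProduct, mul_comm]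
      have hB2 : B2a0 N₀ N a *ᵥ x = (Pi.single (Sum.inl 0) 1 ⬝ᵥ x) •
          (fun i : Fin (N - N₀) => a (N₀ + 1 + i.1)) := by
        ext i
        simp [B2a0, mulVec, dotProduct, mul_comm, Pi.single_apply]
      have e1 : (fun j => C1 N₀ N c 0 j) = fun i : Fin (N - N₀) => c (N₀ + 1 + i.1) := rfl
      have e2 : (fun i => colVec2 N₀ N b i 0) = fun i : Fin (N - N₀) => b (N₀ + 1 + i.1) := rfl
      simp only [Fmat, fromBlocks_mulVec, Sum.elim_comp_inl, Sum.elim_comp_inr, zero_mulVec,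
        add_zero, zero_add]
      have hB2' : (colVec2 N₀ N b * K + B2a0 N₀ N a) *ᵥ x =
          ((fun j => K 0 j) ⬝ᵥ x) • (fun i : Fin (N - N₀) => b (N₀ + 1 + i.1))
            + (Pi.single (Sum.inl 0) 1 ⬝ᵥ x) • (fun i : Fin (N - N₀) => a (N₀ + 1 + i.1)) := by
        rw [add_mulVec, hone, hB2, e2]
      rw [hB2', hone (Ltil N₀ L) (C0 N₀ c), hone (Ltil N₀ L) (C1 N₀ N c), neg_mulVec,
        hone L (C1 N₀ N c), e1]
      ext i
      rcases i with ((i | i) | (i | i))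
      · simp only [Sum.elim_inl, Sum.elim_inr, Pi.add_apply, Pi.smul_apply, smul_eq_mul]
        ring
      · simp only [Sum.elim_inl, Sum.elim_inr, Pi.add_apply, Pi.sub_apply, Pi.neg_apply,
          Pi.smul_apply, smul_eq_mul]
        ring
      · simp only [Sum.elim_inl, Sum.elim_inr, Pi.add_apply, Pi.smul_apply, smul_eq_mul]
      · simp only [Sum.elim_inl, Sum.elim_inr, Pi.add_apply, Pi.zero_apply, zero_add]
    have hGv : (Gmat N₀ N na nb K *ᵥ (Sum.elim (Sum.elim x y) (Sum.elim z w))) ⬝ᵥ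
        (Sum.elim (Sum.elim x y) (Sum.elim z w)) =
        na * ((Pi.single (Sum.inl 0) 1 : Fin 1 ⊕ Fin N₀ → ℝ) ⬝ᵥ x) ^ 2
          + nb * ((fun j => K 0 j) ⬝ᵥ x) ^ 2 := by
      have hrow : ∀ (r : Matrix (Fin 1) (ιF N₀ N) ℝ) (t : ιF N₀ N → ℝ),
          ((rᵀ * r) *ᵥ t) ⬝ᵥ t = ((fun j => r 0 j) ⬝ᵥ t) ^ 2 := by
        intro r t
        rw [← mulVec_mulVec, dotProduct_comm, dotProduct_mulVec, vecMul_transpose]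
        simp [mulVec, dotProduct, sq]
      have e1 : (fun j => Erow N₀ N 0 j) =
          Sum.elim (Sum.elim (Pi.single (Sum.inl 0) 1) 0) (Sum.elim 0 0) := by
        ext i
        rcases i with (((i | i) | i) | (i | i)) <;> simp [Erow]
        rw [Subsingleton.elim i 0]; simp
      have e2 : (fun j => Ktil N₀ N K 0 j) =
          Sum.elim (Sum.elim (fun j => K 0 j) 0) (Sum.elim 0 0) := by
        ext i
        rcases i with ((i | i) | (i | i)) <;> simp [Ktil]
      rw [Gmat, add_mulVec, add_dotProduct, smul_mulVec, smul_mulVec, smul_dotProduct,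
        smul_dotProduct, hrow, hrow, e1, e2]
      simp only [sumElim_dotProduct_sumElim, zero_dotProduct, add_zero, smul_eq_mul]
    have hLv : (fun i => Lcal N₀ N L i 0) =
        Sum.elim (Sum.elim (fun i => Ltil N₀ L i 0) (-(fun i => L i 0))) (Sum.elim 0 0) := by
      ext i
      rcases i with ((i | i) | (i | i)) <;> simp [Lcal]
    have hA2 : ∀ t : Fin (N - N₀) → ℝ, t ⬝ᵥ (A2 N₀ N lam qc *ᵥ t) + δ * (t ⬝ᵥ t)
        ≤ -η * (t ⬝ᵥ t) := by
      intro t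
      simp only [A2, mulVec_diagonal, dotProduct, Finset.mul_sum, ← Finset.sum_add_distrib]
      refine Finset.sum_le_sum fun i _ => ?_
      nlinarith [mul_le_mul_of_nonneg_right (hlamη i.1) (mul_self_nonneg (t i))]
    rw [hGv, hFv, hPv, hLv]
    simp only [sumElim_dotProduct_sumElim, smul_dotProduct, dotProduct_add, dotProduct_sub,
      dotProduct_neg, dotProduct_smul, smul_eq_mul, dotProduct_zero]
    have hfx := hf x
    have hhy := hh y
    rw [show (P1 *ᵥ fun i => Ltil N₀ L i 0) ⬝ᵥ x = (P1 *ᵥ x) ⬝ᵥ fun i => Ltil N₀ L i 0 by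
      rw [dotProduct_comm, dotProduct_mulVec, ← mulVec_transpose, hs1]] at hfx
    rw [show (P2 *ᵥ fun i => L i 0) ⬝ᵥ y = (P2 *ᵥ y) ⬝ᵥ fun i => L i 0 by
      rw [dotProduct_comm, dotProduct_mulVec, ← mulVec_transpose, hs2]] at hhy
    have hb' := cs_tail N₀ (N - N₀) b hb z
    have ha' := cs_tail N₀ (N - N₀) a ha z
    rw [dotProduct_comm] at hb' ha'
    have key := hscal _ _ _ _ _ _ _ u _ _ _ _ _ (hnn1 x) (hnn2 y) (dot_self_nonneg z)
      (dot_self_nonneg w) hfx (hcy y) (cs_tail N₀ (N - N₀) c hc w) hhy (he0 x) (he1 x)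
      hb' ha'
    have q1 := hl1 x
    have q2 := mul_le_mul_of_nonneg_left (hl2 y) hp2.le
    have q3 := mul_le_mul_of_nonneg_left (hA2 z) hp3.le
    have q4 := mul_le_mul_of_nonneg_left (hA2 w) hp4.le
    linarith
  · set l := lam (N + 1)
    have hA : 0 ≤ 2 * β * nc / γ := by positivity
    have habs := abs_nonneg (qc + δ)
    have hl1 : 1 ≤ l := by linarith
    have h1 : 2 * β * nc / l ≤ 2 * β * nc := div_le_self (by positivity) hl1
    have h2 : γ * (2 * β * nc / γ) = 2 * β * nc := by field_simp
    have h3 := le_abs_self (qc + δ)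
    have h4 : 2 * γ * (-(1 - 1 / 2) * l + qc + δ) ≤ -(γ * (2 * β * nc / γ)) := by
      nlinarith
    linarith

end
end

section
/- Assume Θ₁ is negative semidefinite and Θ₂ ≤ 0. Then for every X ∈ ℝ^d and every real sequence (w_n)_{n≥N+1} with ∑_{n≥N+1} λ_n² w_n² < ∞, setting u = EX, v = K̃X and ζ = ∑_{n≥N+1} c_n w_n (this series converges absolutely, as do all series below), one has Xᵀ(FᵀP + PF + 2δP)X + 2(XᵀPℒ)ζ + 2γ ∑_{n≥N+1} λ_n(−λ_n + q_c + δ) w_n² + 2γ ∑_{n≥N+1} λ_n (a_n u + b_n v) w_n ≤ 0. (Key dissipation inequality in the proof of Theorem 1.) -/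
open Matrix

theorem aux_summable_mul (f g : ℕ → ℝ) (hf : Summable fun n => f n ^ 2)
    (hg : Summable fun n => g n ^ 2) : Summable fun n => f n * g n := by
  refine Summable.of_norm_bounded (hf.add hg) (fun n => ?_)
  rw [Real.norm_eq_abs, abs_le]
  constructor <;> nlinarith [sq_nonneg (f n + g n), sq_nonneg (f n - g n), sq_nonneg (f n), sq_nonneg (g n)]

theorem aux_cs (f g : ℕ → ℝ) (hf : Summable fun n => f n ^ 2)
    (hg : Summable fun n => g n ^ 2) :
    (∑' n, f n * g n) ^ 2 ≤ (∑' n, f n ^ 2) * ∑' n, g n ^ 2 := by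
  refine le_of_tendsto' ((aux_summable_mul f g hf hg).hasSum.pow 2) (fun s => ?_)
  refine (Finset.sum_mul_sq_le_sq_mul_sq s f g).trans ?_
  exact mul_le_mul (hf.sum_le_tsum s (fun _ _ => sq_nonneg _))
    (hg.sum_le_tsum s (fun _ _ => sq_nonneg _)) (Finset.sum_nonneg fun _ _ => sq_nonneg _)
    (tsum_nonneg fun _ => sq_nonneg _)

theorem aux_series (δ qc α β γ A B C l0 u v : ℝ) (hα : 1 < α) (hβ : 0 < β) (hγ : 0 < γ)
    (l a b c w : ℕ → ℝ) (hl : ∀ n, l0 ≤ l n) (hl0 : 0 < l0)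
    (ha : Summable fun n : ℕ => a n ^ 2) (haA : (∑' n : ℕ, a n ^ 2) ≤ A ^ 2)
    (hb : Summable fun n : ℕ => b n ^ 2) (hbB : (∑' n : ℕ, b n ^ 2) ≤ B ^ 2)
    (hc : Summable fun n : ℕ => c n ^ 2) (hcC : (∑' n : ℕ, c n ^ 2) ≤ C ^ 2)
    (hΘ₂ : 2 * γ * (-(1 - 1 / α) * l0 + qc + δ) + β * C ^ 2 / l0 ≤ 0)
    (hw : Summable fun n : ℕ => l n ^ 2 * w n ^ 2) :
    Summable (fun n : ℕ => c n * w n) ∧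
    Summable (fun n : ℕ => l n * (-l n + qc + δ) * w n ^ 2) ∧
    Summable (fun n : ℕ => l n * (a n * u + b n * v) * w n) ∧
    β * (∑' n, c n * w n) ^ 2 + 2 * γ * (∑' n, l n * (-l n + qc + δ) * w n ^ 2)
      + 2 * γ * (∑' n, l n * (a n * u + b n * v) * w n)
      ≤ α * γ * (A ^ 2 * u ^ 2 + B ^ 2 * v ^ 2) := by
  have hlp : ∀ n, 0 < l n := fun n => hl0.trans_le (hl n)
  have hlw : Summable fun n => (l n * w n) ^ 2 := by simpa only [mul_pow] using hw
  have hw2 : Summable fun n => w n ^ 2 := by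
    refine Summable.of_nonneg_of_le (fun n => sq_nonneg _) (fun n => ?_) (hw.mul_left (l0 ^ 2)⁻¹)
    rw [← div_eq_inv_mul, le_div_iff₀ (by positivity), mul_comm]
    exact mul_le_mul_of_nonneg_right (pow_le_pow_left₀ hl0.le (hl n) 2) (sq_nonneg _)
  have hlw1 : Summable fun n => l n * w n ^ 2 := by
    refine (aux_summable_mul _ _ hlw hw2).congr (fun n => ?_)
    ring
  have h1 := aux_summable_mul c w hc hw2
  have h2 : Summable (fun n : ℕ => l n * (-l n + qc + δ) * w n ^ 2) := by
    refine ((hlw1.mul_left (qc + δ)).sub hw).congr (fun n => ?_)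
    ring
  have h3 : Summable (fun n : ℕ => l n * (a n * u + b n * v) * w n) := by
    refine (((aux_summable_mul a _ ha hlw).mul_left u).add
      ((aux_summable_mul b _ hb hlw).mul_left v)).congr (fun n => ?_)
    ring
  refine ⟨h1, h2, h3, ?_⟩
  have hcs : (∑' n, c n * w n) ^ 2 ≤ C ^ 2 * ∑' n, w n ^ 2 :=
    (aux_cs c w hc hw2).trans
      (mul_le_mul_of_nonneg_right hcC (tsum_nonneg fun _ => sq_nonneg _))
  have hα0 : 0 < α := by linarith
  have key : ∀ n, β * C ^ 2 * w n ^ 2 + 2 * γ * (l n * (-l n + qc + δ) * w n ^ 2)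
      + 2 * γ * (l n * (a n * u + b n * v) * w n)
      ≤ α * γ * u ^ 2 * a n ^ 2 + α * γ * v ^ 2 * b n ^ 2 := by
    intro n
    have young : ∀ x : ℝ, 2 * (l n * w n) * x ≤ α * x ^ 2 + 1 / α * (l n * w n) ^ 2 := by
      intro x
      have : α * x ^ 2 + 1 / α * (l n * w n) ^ 2 - 2 * (l n * w n) * x
          = 1 / α * (α * x - l n * w n) ^ 2 := by field_simp; ring
      have h : 0 ≤ 1 / α * (α * x - l n * w n) ^ 2 := by positivity
      linarith
    have ya := mul_le_mul_of_nonneg_left (young (a n * u)) hγ.le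
    have yb := mul_le_mul_of_nonneg_left (young (b n * v)) hγ.le
    have hθ : 2 * γ * (-(1 - 1 / α) * l n + qc + δ) + β * C ^ 2 / l n ≤ 0 := by
      refine le_trans ?_ hΘ₂
      have e1 : β * C ^ 2 / l n ≤ β * C ^ 2 / l0 :=
        div_le_div_of_nonneg_left (by positivity) hl0 (hl n)
      have e2 : 0 ≤ 1 - 1 / α := by
        have : 1 / α ≤ 1 := by rw [div_le_one hα0]; exact hα.le
        linarith
      have e3 := mul_le_mul_of_nonneg_left (mul_le_mul_of_nonneg_left (hl n) e2) hγ.le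
      linarith
    have hθ2 : (2 * γ * (-(1 - 1 / α) * l n + qc + δ) + β * C ^ 2 / l n) * (l n * w n ^ 2) ≤ 0 :=
      mul_nonpos_of_nonpos_of_nonneg hθ (mul_nonneg (hlp n).le (sq_nonneg _))
    have e : β * C ^ 2 / l n * (l n * w n ^ 2) = β * C ^ 2 * w n ^ 2 := by
      have := (hlp n).ne'
      field_simp
    rw [add_mul, e] at hθ2
    linarith
  have L := Summable.tsum_le_tsum key
    (((hw2.mul_left (β * C ^ 2)).add (h2.mul_left (2 * γ))).add (h3.mul_left (2 * γ)))
    ((ha.mul_left (α * γ * u ^ 2)).add (hb.mul_left (α * γ * v ^ 2)))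
  rw [Summable.tsum_add ((hw2.mul_left (β * C ^ 2)).add (h2.mul_left (2 * γ))) (h3.mul_left (2 * γ)),
    Summable.tsum_add (hw2.mul_left (β * C ^ 2)) (h2.mul_left (2 * γ)),
    Summable.tsum_add (ha.mul_left (α * γ * u ^ 2)) (hb.mul_left (α * γ * v ^ 2)),
    tsum_mul_left, tsum_mul_left, tsum_mul_left, tsum_mul_left, tsum_mul_left] at L
  have f1 := mul_le_mul_of_nonneg_left haA (by positivity : 0 ≤ α * γ * u ^ 2)
  have f2 := mul_le_mul_of_nonneg_left hbB (by positivity : 0 ≤ α * γ * v ^ 2)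
  have f3 := mul_le_mul_of_nonneg_left hcs hβ.le
  linarith

theorem aux_row {d : ℕ} (E : Matrix (Fin 1) (Fin d) ℝ) (X : Fin d → ℝ) :
    X ⬝ᵥ ((Eᵀ * E).mulVec X) = (E.mulVec X 0) ^ 2 := by
  rw [← Matrix.mulVec_mulVec, Matrix.dotProduct_mulVec, Matrix.vecMul_transpose]
  simp [dotProduct, sq]

theorem aux_block {d : ℕ} (M P : Matrix (Fin d) (Fin d) ℝ) (hP : P.IsSymm)
    (Lc : Matrix (Fin d) (Fin 1) ℝ) (β : ℝ)
    (h : (Matrix.fromBlocks M (P * Lc) (Lcᵀ * P)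
      ((-β) • (1 : Matrix (Fin 1) (Fin 1) ℝ))).NegSemidef) (X : Fin d → ℝ) (z : ℝ) :
    X ⬝ᵥ (M.mulVec X) + 2 * (X ⬝ᵥ fun i => (P * Lc) i 0) * z - β * z ^ 2 ≤ 0 := by
  have h' := h.dotProduct_mulVec_nonneg (Sum.elim X (fun _ => z))
  have ht : Lcᵀ * P = (P * Lc)ᵀ := by rw [Matrix.transpose_mul, hP.eq]
  have e1 : X ⬝ᵥ ((P * Lc).mulVec fun _ => z) = (X ⬝ᵥ fun i => (P * Lc) i 0) * z := by
    simp [dotProduct, Matrix.mulVec, Finset.sum_mul, mul_assoc]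
  have e2 : (fun _ : Fin 1 => z) ⬝ᵥ ((P * Lc)ᵀ.mulVec X) = (X ⬝ᵥ fun i => (P * Lc) i 0) * z := by
    rw [Matrix.mulVec_transpose, dotProduct_comm, ← Matrix.dotProduct_mulVec, e1]
  have e3 : (fun _ : Fin 1 => z) ⬝ᵥ (((-β) • (1 : Matrix (Fin 1) (Fin 1) ℝ)).mulVec fun _ => z)
      = -β * z ^ 2 := by
    rw [Matrix.smul_mulVec, Matrix.one_mulVec]
    simp [dotProduct]; ring
  rw [star_trivial, Matrix.neg_mulVec, dotProduct_neg, ht, Matrix.fromBlocks_mulVec,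
    sumElim_dotProduct_sumElim, Sum.elim_comp_inl, Sum.elim_comp_inr, dotProduct_add,
    dotProduct_add, e1, e2, e3] at h'
  linarith

/-- Key dissipation inequality in the proof of Theorem 1 (bounded
observation operator): if `Θ₁ ⪯ 0` and `Θ₂ ≤ 0`, then for every `X ∈ ℝ^d` and every
square-summable-against-`λ²` tail sequence `(w_n)_{n ≥ N+1}`, with `u = EX`,
`v = K̃X`, `ζ = ∑_{n≥N+1} c_n w_n`, one has
`Xᵀ(FᵀP + PF + 2δP)X + 2(XᵀPℒ)ζ + 2γ ∑ λ_n(-λ_n+q_c+δ)w_n² + 2γ ∑ λ_n(a_n u + b_n v)w_n ≤ 0`,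
all series converging absolutely. -/
theorem dissipation_inequality_bounded_observation
    (N d : ℕ) (hd : 1 ≤ d)
    (δ qc α β γ : ℝ) (hδ : 0 < δ) (hα : 1 < α) (hβ : 0 < β) (hγ : 0 < γ)
    (F P : Matrix (Fin d) (Fin d) ℝ) (hP : P.IsSymm)
    (Lc : Matrix (Fin d) (Fin 1) ℝ)
    (E Kt : Matrix (Fin 1) (Fin d) ℝ)
    (A B C : ℝ) (hA : 0 ≤ A) (hB : 0 ≤ B) (hC : 0 ≤ C)
    (lam a b c : ℕ → ℝ)
    (hlam : ∀ n, N + 1 ≤ n → lam (N + 1) ≤ lam n) (hlampos : 0 < lam (N + 1))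
    (ha : Summable fun n : ℕ => a (N + 1 + n) ^ 2)
    (haA : (∑' n : ℕ, a (N + 1 + n) ^ 2) ≤ A ^ 2)
    (hb : Summable fun n : ℕ => b (N + 1 + n) ^ 2)
    (hbB : (∑' n : ℕ, b (N + 1 + n) ^ 2) ≤ B ^ 2)
    (hc : Summable fun n : ℕ => c (N + 1 + n) ^ 2)
    (hcC : (∑' n : ℕ, c (N + 1 + n) ^ 2) ≤ C ^ 2)
    (hΘ₁ : (Matrix.fromBlocks
        (Fᵀ * P + P * F + (2 * δ) • P +
          (α * γ) • (A ^ 2 • (Eᵀ * E) + B ^ 2 • (Ktᵀ * Kt)))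
        (P * Lc) (Lcᵀ * P) ((-β) • (1 : Matrix (Fin 1) (Fin 1) ℝ))).NegSemidef)
    (hΘ₂ : 2 * γ * (-(1 - 1 / α) * lam (N + 1) + qc + δ) + β * C ^ 2 / lam (N + 1) ≤ 0)
    (X : Fin d → ℝ) (w : ℕ → ℝ)
    (hw : Summable fun n : ℕ => lam (N + 1 + n) ^ 2 * w (N + 1 + n) ^ 2) :
    Summable (fun n : ℕ => |c (N + 1 + n) * w (N + 1 + n)|) ∧
    Summable (fun n : ℕ =>
      |lam (N + 1 + n) * (-lam (N + 1 + n) + qc + δ) * w (N + 1 + n) ^ 2|) ∧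
    Summable (fun n : ℕ =>
      |lam (N + 1 + n) * (a (N + 1 + n) * (E.mulVec X 0) + b (N + 1 + n) * (Kt.mulVec X 0))
        * w (N + 1 + n)|) ∧
    X ⬝ᵥ ((Fᵀ * P + P * F + (2 * δ) • P).mulVec X)
      + 2 * (X ⬝ᵥ fun i => (P * Lc) i 0) * (∑' n : ℕ, c (N + 1 + n) * w (N + 1 + n))
      + 2 * γ * (∑' n : ℕ,
          lam (N + 1 + n) * (-lam (N + 1 + n) + qc + δ) * w (N + 1 + n) ^ 2)
      + 2 * γ * (∑' n : ℕ,
          lam (N + 1 + n) * (a (N + 1 + n) * (E.mulVec X 0) + b (N + 1 + n) * (Kt.mulVec X 0))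
            * w (N + 1 + n)) ≤ 0 := by
  obtain ⟨h1, h2, h3, h4⟩ := aux_series δ qc α β γ A B C (lam (N + 1)) (E.mulVec X 0)
    (Kt.mulVec X 0) hα hβ hγ (fun n => lam (N + 1 + n)) (fun n => a (N + 1 + n))
    (fun n => b (N + 1 + n)) (fun n => c (N + 1 + n)) (fun n => w (N + 1 + n))
    (fun n => hlam _ (Nat.le_add_right _ _)) hlampos ha haA hb hbB hc hcC hΘ₂ hw
  refine ⟨h1.abs, h2.abs, h3.abs, ?_⟩
  have h5 := aux_block _ P hP Lc β hΘ₁ X (∑' n : ℕ, c (N + 1 + n) * w (N + 1 + n))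
  generalize Fᵀ * P + P * F + (2 * δ) • P = M at h5 ⊢
  rw [Matrix.add_mulVec M ((α * γ) • _), dotProduct_add, Matrix.smul_mulVec, Matrix.add_mulVec,
    Matrix.smul_mulVec, Matrix.smul_mulVec, dotProduct_smul, dotProduct_add, dotProduct_smul,
    dotProduct_smul, aux_row, aux_row, smul_eq_mul, smul_eq_mul, smul_eq_mul] at h5
  linarith
end

section
/- Assume Θ₁ is negative semidefinite, Θ₂ ≤ 0 and Θ₃ ≥ 0. Then for every X ∈ ℝ^d and every real sequence (w_n)_{n≥N+1} with ∑_{n≥N+1} λ_n² w_n² < ∞, setting u = EX, v = K̃X and ζ = ∑_{n≥N+1} y_n w_n (this series converges absolutely, as do all series below), one has Xᵀ(FᵀP + PF + 2δP)X + 2(XᵀPℒ)ζ + 2γ ∑_{n≥N+1} λ_n(−λ_n + q_c + δ) w_n² + 2γ ∑_{n≥N+1} λ_n (a_n u + b_n v) w_n ≤ 0. (Key dissipation inequality in the proof of Theorem 3; it uses that for each n ≥ N+1 the quantity Γ_n = 2γ(−(1−1/α)λ_n + q_c + δ) + βM₂(ε)λ_n^{1/2+ε} satisfies Γ_n ≤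 −Θ₃λ_n + 2γ(q_c+δ) ≤ Θ₂.) -/
open Matrix

theorem quad_aux {d : ℕ} (M P : Matrix (Fin d) (Fin d) ℝ) (hP : P.IsSymm)
    (Lc : Matrix (Fin d) (Fin 1) ℝ) (E Kt : Matrix (Fin 1) (Fin d) ℝ) (c A B β : ℝ)
    (h : (Matrix.fromBlocks
        (M + c • (A ^ 2 • (Eᵀ * E) + B ^ 2 • (Ktᵀ * Kt)))
        (P * Lc) (Lcᵀ * P) ((-β) • (1 : Matrix (Fin 1) (Fin 1) ℝ))).NegSemidef)
    (X : Fin d → ℝ) (z : ℝ) :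
    X ⬝ᵥ (M.mulVec X) + c * (A ^ 2 * (E.mulVec X 0) ^ 2 + B ^ 2 * (Kt.mulVec X 0) ^ 2)
      + 2 * (X ⬝ᵥ fun i => (P * Lc) i 0) * z - β * z ^ 2 ≤ 0 := by
  have h1 := h.dotProduct_mulVec_nonneg (Sum.elim X (fun _ => z))
  have hE : ∀ E : Matrix (Fin 1) (Fin d) ℝ, X ⬝ᵥ ((Eᵀ * E).mulVec X) = (E.mulVec X 0) ^ 2 := by
    intro E
    rw [← Matrix.mulVec_mulVec, Matrix.dotProduct_mulVec, Matrix.vecMul_transpose]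
    simp [dotProduct, sq]
  have hL1 : X ⬝ᵥ ((P * Lc).mulVec (fun _ => z)) = (X ⬝ᵥ fun i => (P * Lc) i 0) * z := by
    simp [dotProduct, Matrix.mulVec, Finset.sum_mul, mul_assoc]
  have hL2 : (fun _ => z) ⬝ᵥ ((Lcᵀ * P).mulVec X) = (X ⬝ᵥ fun i => (P * Lc) i 0) * z := by
    have : Lcᵀ * P = (P * Lc)ᵀ := by rw [Matrix.transpose_mul, hP.eq]
    rw [this, ← hL1, Matrix.dotProduct_mulVec, Matrix.vecMul_transpose, dotProduct_comm]
  have hz : (fun _ : Fin 1 => z) ⬝ᵥ (((-β) • (1 : Matrix (Fin 1) (Fin 1) ℝ)).mulVec (fun _ => z))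
      = - β * z ^ 2 := by
    simp [dotProduct, Matrix.mulVec]; ring
  rw [star_trivial, Matrix.neg_mulVec, dotProduct_neg, Matrix.fromBlocks_mulVec,
    sumElim_dotProduct_sumElim] at h1
  simp only [Sum.elim_comp_inl, Sum.elim_comp_inr, dotProduct_add, Matrix.add_mulVec,
    Matrix.smul_mulVec, dotProduct_smul, hE, hL1, hL2, smul_eq_mul] at h1
  simp only [Matrix.smul_mulVec, dotProduct_smul, smul_eq_mul] at hz
  rw [hz] at h1
  linarith

theorem cs_aux (y w p : ℕ → ℝ) (hp : ∀ n, 0 < p n)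
    (hy : Summable fun n => y n ^ 2 / p n) (hw : Summable fun n => p n * w n ^ 2) :
    Summable (fun n => |y n * w n|) ∧
    (∑' n, y n * w n) ^ 2 ≤ (∑' n, y n ^ 2 / p n) * ∑' n, p n * w n ^ 2 := by
  have h1 : Summable (fun n => |y n * w n|) := by
    refine Summable.of_nonneg_of_le (fun n => abs_nonneg _) (fun n => ?_) (hy.add hw)
    have hpn := hp n
    have e : y n ^ 2 / p n * p n = y n ^ 2 := by field_simp
    have h0 : 0 ≤ y n ^ 2 / p n := by positivity
    have h0' : 0 ≤ p n * w n ^ 2 := by positivity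
    apply abs_le_of_sq_le_sq _ (by positivity)
    have : (y n * w n) ^ 2 = (y n ^ 2 / p n) * (p n * w n ^ 2) := by field_simp
    rw [this]
    nlinarith
  refine ⟨h1, ?_⟩
  have hs : Summable (fun n => y n * w n) := h1.of_abs
  refine le_of_tendsto' (hs.hasSum.pow 2) (fun s => ?_)
  have h0 : ∀ n, 0 ≤ y n ^ 2 / p n := fun n => by have := hp n; positivity
  have h0' : ∀ n, 0 ≤ p n * w n ^ 2 := fun n => by have := hp n; positivity
  calc (∑ n ∈ s, y n * w n) ^ 2 ≤ (∑ n ∈ s, y n ^ 2 / p n) * ∑ n ∈ s, p n * w n ^ 2 := by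
        apply Finset.sum_sq_le_sum_mul_sum_of_sq_le_mul s (fun i _ => h0 i) (fun i _ => h0' i)
        intro i _
        have := hp i
        apply le_of_eq
        field_simp
    _ ≤ _ := by
        apply mul_le_mul (hy.sum_le_tsum s (fun i _ => h0 i)) (hw.sum_le_tsum s (fun i _ => h0' i))
          (Finset.sum_nonneg fun i _ => h0' i) (tsum_nonneg h0)

theorem young_aux (a b l w : ℕ → ℝ) (α u v : ℝ) (hα : 0 < α)
    (ha : Summable fun n => a n ^ 2) (hb : Summable fun n => b n ^ 2)
    (hw : Summable fun n => l n ^ 2 * w n ^ 2) :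
    Summable (fun n => |l n * (a n * u + b n * v) * w n|) ∧
    2 * (∑' n, l n * (a n * u + b n * v) * w n) ≤
      α * ((∑' n, a n ^ 2) * u ^ 2 + (∑' n, b n ^ 2) * v ^ 2)
        + 2 / α * ∑' n, l n ^ 2 * w n ^ 2 := by
  have key : ∀ n, ∀ s : ℝ, s = 1 ∨ s = -1 → 2 * (s * (l n * (a n * u + b n * v) * w n)) ≤
      α * (a n ^ 2 * u ^ 2 + b n ^ 2 * v ^ 2) + 2 / α * (l n ^ 2 * w n ^ 2) := by
    intro n s hs
    have hs2 : s ^ 2 = 1 := by rcases hs with h | h <;> rw [h] <;> norm_num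
    have h1 : 0 ≤ (α * (a n * u) - s * (l n * w n)) ^ 2 / α := by positivity
    have h2 : 0 ≤ (α * (b n * v) - s * (l n * w n)) ^ 2 / α := by positivity
    have e : ∀ t : ℝ, (α * t - s * (l n * w n)) ^ 2 / α
        = α * t ^ 2 - 2 * s * t * (l n * w n) + 1 / α * (l n ^ 2 * w n ^ 2) := by
      intro t
      have : (α * t - s * (l n * w n)) ^ 2 = α ^ 2 * t ^ 2 - 2 * α * s * t * (l n * w n)
        + s ^ 2 * (l n ^ 2 * w n ^ 2) := by ring
      rw [this, hs2]; field_simp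
    rw [e] at h1 h2
    have : 2 / α * (l n ^ 2 * w n ^ 2) = 2 * (1 / α * (l n ^ 2 * w n ^ 2)) := by ring
    rw [this]
    nlinarith
  have S : Summable fun n => α * (a n ^ 2 * u ^ 2 + b n ^ 2 * v ^ 2)
      + 2 / α * (l n ^ 2 * w n ^ 2) :=
    (((ha.mul_right _).add (hb.mul_right _)).mul_left _).add (hw.mul_left _)
  have h1 : Summable (fun n => |l n * (a n * u + b n * v) * w n|) := by
    refine Summable.of_nonneg_of_le (fun n => abs_nonneg _) (fun n => ?_) (S.mul_left (1/2))
    have k1 := key n 1 (Or.inl rfl)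
    have k2 := key n (-1) (Or.inr rfl)
    apply abs_le.2
    constructor <;> linarith
  refine ⟨h1, ?_⟩
  have h2 : ∑' n, 2 * (l n * (a n * u + b n * v) * w n) ≤ _ :=
    (h1.of_abs.mul_left 2).tsum_le_tsum (fun n => by simpa using key n 1 (Or.inl rfl)) S
  rw [tsum_mul_left, Summable.tsum_add (((ha.mul_right _).add (hb.mul_right _)).mul_left _)
    (hw.mul_left _), tsum_mul_left, tsum_mul_left, Summable.tsum_add (ha.mul_right _)
    (hb.mul_right _), tsum_mul_right, tsum_mul_right] at h2
  exact h2

theorem pow_aux (x0 x ε : ℝ) (hε : ε ≤ 1 / 2) (h0 : 0 < x0) (h : x0 ≤ x) :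
    x ^ (1 / 2 + ε : ℝ) ≤ x / x0 ^ (1 / 2 - ε : ℝ) := by
  have hx : 0 < x := h0.trans_le h
  rw [le_div_iff₀ (by positivity)]
  calc x ^ (1 / 2 + ε : ℝ) * x0 ^ (1 / 2 - ε : ℝ)
      ≤ x ^ (1 / 2 + ε : ℝ) * x ^ (1 / 2 - ε : ℝ) := by
        gcongr
    _ = x := by rw [← Real.rpow_add hx]; norm_num

theorem main_aux (qc δ α β γ ε l0 u v A B : ℝ) (hα : 1 < α) (hβ : 0 < β) (hγ : 0 < γ)
    (hε : ε ≤ 1 / 2) (l a b y w : ℕ → ℝ) (hl : ∀ n, l0 ≤ l n) (hl0 : 0 < l0)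
    (ha : Summable fun n => a n ^ 2) (haA : ∑' n, a n ^ 2 ≤ A ^ 2)
    (hb : Summable fun n => b n ^ 2) (hbB : ∑' n, b n ^ 2 ≤ B ^ 2)
    (hy : Summable fun n => y n ^ 2 / l n ^ (3 / 2 + ε : ℝ))
    (h2 : 2 * γ * (-(1 - 1 / α) * l0 + qc + δ)
      + β * (∑' n : ℕ, y n ^ 2 / l n ^ (3 / 2 + ε : ℝ)) * l0 ^ (1 / 2 + ε : ℝ) ≤ 0)
    (h3 : 2 * γ * (1 - 1 / α)
      - β * (∑' n : ℕ, y n ^ 2 / l n ^ (3 / 2 + ε : ℝ)) / l0 ^ (1 / 2 - ε : ℝ) ≥ 0)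
    (hw : Summable fun n => l n ^ 2 * w n ^ 2) :
    Summable (fun n => |y n * w n|) ∧
    Summable (fun n => |l n * (-l n + qc + δ) * w n ^ 2|) ∧
    Summable (fun n => |l n * (a n * u + b n * v) * w n|) ∧
    β * (∑' n, y n * w n) ^ 2 + 2 * γ * (∑' n, l n * (-l n + qc + δ) * w n ^ 2)
      + 2 * γ * (∑' n, l n * (a n * u + b n * v) * w n)
      ≤ α * γ * (A ^ 2 * u ^ 2 + B ^ 2 * v ^ 2) := by
  have lpos : ∀ n, 0 < l n := fun n => hl0.trans_le (hl n)
  have hpow : ∀ n, l n ^ (3 / 2 + ε : ℝ) = l n * l n ^ (1 / 2 + ε : ℝ) := by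
    intro n
    rw [show (3 / 2 + ε : ℝ) = 1 + (1 / 2 + ε) by ring, Real.rpow_add (lpos n), Real.rpow_one]
  have hp1 : ∀ n, l n ^ (1 / 2 + ε : ℝ) ≤ l n / l0 ^ (1 / 2 - ε : ℝ) :=
    fun n => pow_aux l0 (l n) ε hε hl0 (hl n)
  have hp0 : l0 ^ (1 / 2 + ε : ℝ) = l0 / l0 ^ (1 / 2 - ε : ℝ) := by
    rw [eq_div_iff (by positivity), ← Real.rpow_add hl0]; norm_num
  have ppos : ∀ n, 0 < l n ^ (3 / 2 + ε : ℝ) := fun n => Real.rpow_pos_of_pos (lpos n) _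
  have hM0 : 0 ≤ ∑' n : ℕ, y n ^ 2 / l n ^ (3 / 2 + ε : ℝ) :=
    tsum_nonneg fun n => div_nonneg (sq_nonneg _) (ppos n).le
  have hS : Summable fun n => l n ^ (3 / 2 + ε : ℝ) * w n ^ 2 := by
    refine Summable.of_nonneg_of_le (fun n => mul_nonneg (ppos n).le (sq_nonneg _)) (fun n => ?_)
      (hw.mul_left (1 / l0 ^ (1 / 2 - ε : ℝ)))
    rw [hpow]
    have := mul_le_mul_of_nonneg_left (hp1 n) (mul_nonneg (lpos n).le (sq_nonneg (w n)))
    calc _ = l n * w n ^ 2 * l n ^ (1 / 2 + ε : ℝ) := by ring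
      _ ≤ _ := this
      _ = _ := by ring
  obtain ⟨c1, c2⟩ := cs_aux y w _ ppos hy hS
  obtain ⟨d1, d2⟩ := young_aux a b l w α u v (by linarith) ha hb hw
  have hq : Summable fun n => l n * w n ^ 2 := by
    refine Summable.of_nonneg_of_le (fun n => mul_nonneg (lpos n).le (sq_nonneg _)) (fun n => ?_)
      (hw.mul_left (1 / l0))
    have h1 : 1 ≤ l n / l0 := (one_le_div hl0).2 (hl n)
    have := mul_le_mul_of_nonneg_left h1 (mul_nonneg (lpos n).le (sq_nonneg (w n)))
    calc _ = l n * w n ^ 2 * 1 := by ring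
      _ ≤ _ := this
      _ = _ := by ring
  have hr : Summable fun n => l n * (-l n + qc + δ) * w n ^ 2 := by
    refine ((hq.mul_left (qc + δ)).sub hw).congr fun n => ?_
    ring
  refine ⟨c1, hr.abs, d1, ?_⟩
  set M := ∑' n : ℕ, y n ^ 2 / l n ^ (3 / 2 + ε : ℝ) with hM
  set D := l0 ^ (1 / 2 - ε : ℝ) with hD
  have hDpos : 0 < D := by positivity
  have hterm : ∀ n, β * M * (l n ^ (3 / 2 + ε : ℝ) * w n ^ 2)
      + 2 * γ * (l n * (-l n + qc + δ) * w n ^ 2) + γ * (2 / α) * (l n ^ 2 * w n ^ 2) ≤ 0 := by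
    intro n
    have e : β * M * (l n ^ (3 / 2 + ε : ℝ) * w n ^ 2)
      + 2 * γ * (l n * (-l n + qc + δ) * w n ^ 2) + γ * (2 / α) * (l n ^ 2 * w n ^ 2)
      = (l n * w n ^ 2) * (2 * γ * (-(1 - 1 / α) * l n + qc + δ)
        + β * M * l n ^ (1 / 2 + ε : ℝ)) := by
      rw [hpow]; ring
    rw [e]
    apply mul_nonpos_of_nonneg_of_nonpos (mul_nonneg (lpos n).le (sq_nonneg _))
    have f1 := mul_le_mul_of_nonneg_left (hp1 n) (mul_nonneg hβ.le hM0)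
    have f2 := mul_le_mul_of_nonneg_left (hl n) h3
    rw [hp0] at h2
    have g1 : β * M * (l n / D) = β * M / D * l n := by ring
    have g2 : β * M * (l0 / D) = β * M / D * l0 := by ring
    rw [g1] at f1
    rw [g2] at h2
    nlinarith
  have hsum := tsum_nonpos (L := SummationFilter.unconditional ℕ) hterm
  rw [Summable.tsum_add ((hS.mul_left _).add (hr.mul_left _)) (hw.mul_left _),
    Summable.tsum_add (hS.mul_left _) (hr.mul_left _), tsum_mul_left, tsum_mul_left,
    tsum_mul_left] at hsum
  have c3 := mul_le_mul_of_nonneg_left c2 hβ.le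
  have d3 := mul_le_mul_of_nonneg_left d2 hγ.le
  have a3 := mul_le_mul_of_nonneg_right haA (sq_nonneg u)
  have b3 := mul_le_mul_of_nonneg_right hbB (sq_nonneg v)
  have ab := mul_le_mul_of_nonneg_left (add_le_add a3 b3)
    (mul_nonneg (by linarith : (0:ℝ) ≤ α) hγ.le)
  linarith

/-- Key dissipation inequality in the proof of Theorem 3 (Neumann
boundary measurement): if `Θ₁ ⪯ 0`, `Θ₂ ≤ 0` and `Θ₃ ≥ 0` (with `Θ₂`, `Θ₃` built from
`M₂(ε) = ∑_{n≥N+1} y_n²/λ_n^{3/2+ε}`), then for every `X ∈ ℝ^d` and every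
square-summable-against-`λ²` tail sequence `(w_n)_{n ≥ N+1}`, with `u = EX`,
`v = K̃X`, `ζ = ∑_{n≥N+1} y_n w_n`, one has
`Xᵀ(FᵀP + PF + 2δP)X + 2(XᵀPℒ)ζ + 2γ ∑ λ_n(-λ_n+q_c+δ)w_n² + 2γ ∑ λ_n(a_n u + b_n v)w_n ≤ 0`,
all series converging absolutely. -/
theorem dissipation_inequality_neumann_measurement
    (N d : ℕ) (hd : 1 ≤ d)
    (δ qc α β γ ε : ℝ) (hδ : 0 < δ) (hα : 1 < α) (hβ : 0 < β) (hγ : 0 < γ)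
    (hε : 0 < ε ∧ ε ≤ 1 / 2)
    (F P : Matrix (Fin d) (Fin d) ℝ) (hP : P.IsSymm)
    (Lc : Matrix (Fin d) (Fin 1) ℝ)
    (E Kt : Matrix (Fin 1) (Fin d) ℝ)
    (A B : ℝ) (hA : 0 ≤ A) (hB : 0 ≤ B)
    (lam a b y : ℕ → ℝ)
    (hlam : ∀ n, N + 1 ≤ n → lam (N + 1) ≤ lam n) (hlampos : 0 < lam (N + 1))
    (ha : Summable fun n : ℕ => a (N + 1 + n) ^ 2)
    (haA : (∑' n : ℕ, a (N + 1 + n) ^ 2) ≤ A ^ 2)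
    (hb : Summable fun n : ℕ => b (N + 1 + n) ^ 2)
    (hbB : (∑' n : ℕ, b (N + 1 + n) ^ 2) ≤ B ^ 2)
    (hy : Summable fun n : ℕ =>
      y (N + 1 + n) ^ 2 / lam (N + 1 + n) ^ (3 / 2 + ε : ℝ))
    (hΘ₁ : (Matrix.fromBlocks
        (Fᵀ * P + P * F + (2 * δ) • P +
          (α * γ) • (A ^ 2 • (Eᵀ * E) + B ^ 2 • (Ktᵀ * Kt)))
        (P * Lc) (Lcᵀ * P) ((-β) • (1 : Matrix (Fin 1) (Fin 1) ℝ))).NegSemidef)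
    (hΘ₂ : 2 * γ * (-(1 - 1 / α) * lam (N + 1) + qc + δ)
      + β * (∑' n : ℕ, y (N + 1 + n) ^ 2 / lam (N + 1 + n) ^ (3 / 2 + ε : ℝ))
          * lam (N + 1) ^ (1 / 2 + ε : ℝ) ≤ 0)
    (hΘ₃ : 2 * γ * (1 - 1 / α)
      - β * (∑' n : ℕ, y (N + 1 + n) ^ 2 / lam (N + 1 + n) ^ (3 / 2 + ε : ℝ))
          / lam (N + 1) ^ (1 / 2 - ε : ℝ) ≥ 0)
    (X : Fin d → ℝ) (w : ℕ → ℝ)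
    (hw : Summable fun n : ℕ => lam (N + 1 + n) ^ 2 * w (N + 1 + n) ^ 2) :
    Summable (fun n : ℕ => |y (N + 1 + n) * w (N + 1 + n)|) ∧
    Summable (fun n : ℕ =>
      |lam (N + 1 + n) * (-lam (N + 1 + n) + qc + δ) * w (N + 1 + n) ^ 2|) ∧
    Summable (fun n : ℕ =>
      |lam (N + 1 + n) * (a (N + 1 + n) * (E.mulVec X 0) + b (N + 1 + n) * (Kt.mulVec X 0))
        * w (N + 1 + n)|) ∧
    X ⬝ᵥ ((Fᵀ * P + P * F + (2 * δ) • P).mulVec X)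
      + 2 * (X ⬝ᵥ fun i => (P * Lc) i 0) * (∑' n : ℕ, y (N + 1 + n) * w (N + 1 + n))
      + 2 * γ * (∑' n : ℕ,
          lam (N + 1 + n) * (-lam (N + 1 + n) + qc + δ) * w (N + 1 + n) ^ 2)
      + 2 * γ * (∑' n : ℕ,
          lam (N + 1 + n) * (a (N + 1 + n) * (E.mulVec X 0) + b (N + 1 + n) * (Kt.mulVec X 0))
            * w (N + 1 + n)) ≤ 0 := by
  have hm := main_aux qc δ α β γ ε (lam (N + 1)) (E.mulVec X 0) (Kt.mulVec X 0) A B hα hβ hγ hε.2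
    (fun n => lam (N + 1 + n)) (fun n => a (N + 1 + n)) (fun n => b (N + 1 + n))
    (fun n => y (N + 1 + n)) (fun n => w (N + 1 + n)) (fun n => hlam _ (by omega)) hlampos
    ha haA hb hbB hy hΘ₂ hΘ₃ hw
  obtain ⟨m1, m2, m3, m4⟩ := hm
  refine ⟨m1, m2, m3, ?_⟩
  have hq := quad_aux _ P hP Lc E Kt _ A B β hΘ₁ X (∑' n : ℕ, y (N + 1 + n) * w (N + 1 + n))
  linarith
end

section
/- The Kalman controllability matrix [B₁ | A₁B₁ | … | A₁^{N₀}B₁] ∈ ℝ^{(N₀+1)×(N₀+1)} is invertible if and only if a_i + (−λ_i + q_c) b_i ≠ 0 for all 1 ≤ i ≤ N₀. (Controllability of the pair (A₁,B₁), Remark 1.) -/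
open Matrix

/-- The Kalman controllability matrix `[B₁ | A₁B₁ | … | A₁^{N₀}B₁]`
is invertible iff `aᵢ + (-λᵢ + q_c) bᵢ ≠ 0` for all `1 ≤ i ≤ N₀`, where
`A₁ = [[0, 0], [B_{0,a}, A₀]]` with `A₀ = diag(-λ₁+q_c, …, -λ_{N₀}+q_c)` and
`B₁ = (1, b₁, …, b_{N₀})ᵀ`. -/
theorem kalman_controllability
    (N₀ : ℕ) (hN₀ : 1 ≤ N₀) (qc : ℝ) (lam a b : ℕ → ℝ)
    (hdist : ∀ i j, 1 ≤ i → i ≤ N₀ → 1 ≤ j → j ≤ N₀ → lam i = lam j → i = j) :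
    let A₁ : Matrix (Fin (N₀ + 1)) (Fin (N₀ + 1)) ℝ := Matrix.of fun i j =>
      if i.val = 0 then 0
      else if j.val = 0 then a i.val
      else if i = j then -lam i.val + qc else 0
    let B₁ : Fin (N₀ + 1) → ℝ := fun i => if i.val = 0 then 1 else b i.val
    IsUnit (Matrix.of fun i j : Fin (N₀ + 1) => ((A₁ ^ (j.val)).mulVec B₁) i) ↔
      ∀ i, 1 ≤ i → i ≤ N₀ → a i + (-lam i + qc) * b i ≠ 0 := by
  intro A₁ B₁
  have hpow : ∀ (k : ℕ) (i : Fin (N₀ + 1)), ((A₁ ^ (k + 1)).mulVec B₁) i =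
      if i.val = 0 then 0
      else (-lam i.val + qc) ^ k * (a i.val + (-lam i.val + qc) * b i.val) := by
    intro k
    induction k with
    | zero =>
      intro i
      rw [zero_add, pow_one, Matrix.mulVec, dotProduct, Fin.sum_univ_succ]
      refine Fin.cases ?_ (fun i => ?_) i
      · simp [A₁]
      · simp [A₁, B₁, Fin.succ_inj]
    | succ k ih =>
      intro i
      rw [pow_succ', ← Matrix.mulVec_mulVec, Matrix.mulVec, dotProduct, Fin.sum_univ_succ]
      simp only [ih]
      refine Fin.cases ?_ (fun i => ?_) i
      · simp [A₁]
      · simp [A₁, Fin.succ_inj]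
        ring
  have hdet : (Matrix.of fun i j : Fin (N₀ + 1) => ((A₁ ^ (j.val)).mulVec B₁) i).det =
      (∏ i : Fin N₀, (a (i.val + 1) + (-lam (i.val + 1) + qc) * b (i.val + 1))) *
        (Matrix.vandermonde fun i : Fin N₀ => -lam (i.val + 1) + qc).det := by
    rw [Matrix.det_succ_row_zero, Fin.sum_univ_succ, ← Matrix.det_mul_column]
    have h0 : ∀ j : Fin N₀, (Matrix.of fun i j : Fin (N₀ + 1) =>
        ((A₁ ^ (j.val)).mulVec B₁) i) 0 j.succ = 0 := by
      intro j
      simp only [Matrix.of_apply, Fin.val_succ, hpow]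
      simp
    simp only [h0, mul_zero, zero_mul, Finset.sum_const_zero, add_zero]
    have h1 : (Matrix.of fun i j : Fin (N₀ + 1) =>
        ((A₁ ^ (j.val)).mulVec B₁) i) 0 0 = 1 := by
      simp [B₁]
    rw [h1]
    simp only [Fin.val_zero, pow_zero, one_mul]
    congr 1
    ext i j
    simp only [Matrix.submatrix_apply, Matrix.of_apply, Fin.zero_succAbove, Fin.val_succ, hpow,
      Matrix.vandermonde_apply]
    simp [mul_comm]
  have hv : (Matrix.vandermonde fun i : Fin N₀ => -lam (i.val + 1) + qc).det ≠ 0 := by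
    rw [Matrix.det_vandermonde_ne_zero_iff]
    intro i j hij
    have := hdist (i.val + 1) (j.val + 1) (by omega) (by omega) (by omega) (by omega)
      (by simpa using hij)
    ext
    omega
  rw [Matrix.isUnit_iff_isUnit_det, hdet, isUnit_iff_ne_zero, mul_ne_zero_iff,
    and_iff_left hv, Finset.prod_ne_zero_iff]
  constructor
  · intro h i hi hi'
    have := h ⟨i - 1, by omega⟩ (Finset.mem_univ _)
    simpa [Nat.sub_add_cancel hi] using this
  · intro h i _
    exact h _ (by omega) (by omega)
end

section
/- With a(x) = 2p(x) + 2x p'(x) + (q_c − q(x))x² and b(x) = −x², one has ∫₀¹ a(x)φ(x) dx + (−λ + q_c) ∫₀¹ b(x)φ(x) dx = −p(1)φ'(1). (Integration-by-parts identity a_n + (−λ_n + q_c)b_n = −p(1)φ_n'(1) of Remark 1, Dirichlet actuation with Neumann condition at x = 0.) -/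
/-- Integration-by-parts identity
`∫₀¹ a φ + (-λ + q_c) ∫₀¹ b φ = -p(1) φ'(1)` where
`a(x) = 2p(x) + 2x p'(x) + (q_c - q(x)) x²` and `b(x) = -x²`, for a Sturm–Liouville
eigenfunction `φ` with `φ'(0) = 0` and `φ(1) = 0`. -/
theorem ibp_identity_dirichlet_neumann
    (p q φ : ℝ → ℝ) (lam qc : ℝ)
    (hp : ContDiff ℝ 1 p) (hq : Continuous q) (hφ : ContDiff ℝ 2 φ)
    (hode : ∀ x ∈ Set.Icc (0 : ℝ) 1,
      -(deriv (fun y => p y * deriv φ y) x) + q x * φ x = lam * φ x)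
    (hbc0 : deriv φ 0 = 0) (hbc1 : φ 1 = 0) :
    (∫ x in (0 : ℝ)..1, (2 * p x + 2 * x * deriv p x + (qc - q x) * x ^ 2) * φ x)
      + (-lam + qc) * ∫ x in (0 : ℝ)..1, (-x ^ 2) * φ x
      = -(p 1 * deriv φ 1) := by
  have hpd : Differentiable ℝ p := hp.differentiable (by norm_num)
  have hφd : Differentiable ℝ φ := hφ.differentiable (by norm_num)
  have hφ1 : ContDiff ℝ 1 (deriv φ) :=
    ((contDiff_succ_iff_deriv (n := 1)).1 (by simpa [one_add_one_eq_two] using hφ)).2.2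
  have hφdd : Differentiable ℝ (deriv φ) := hφ1.differentiable (by norm_num)
  have hpc : Continuous p := hp.continuous
  have hφc : Continuous φ := hφ.continuous
  have hp'c : Continuous (deriv p) := hp.continuous_deriv (by norm_num)
  have hi1 : IntervalIntegrable
      (fun x => (2 * p x + 2 * x * deriv p x + (qc - q x) * x ^ 2) * φ x)
      MeasureTheory.volume 0 1 := Continuous.intervalIntegrable (by fun_prop) _ _
  have hi2 : IntervalIntegrable (fun x => (-lam + qc) * ((-x ^ 2) * φ x))
      MeasureTheory.volume 0 1 := Continuous.intervalIntegrable (by fun_prop) _ _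
  rw [← intervalIntegral.integral_const_mul, ← intervalIntegral.integral_add hi1 hi2]
  have key := intervalIntegral.integral_eq_sub_of_hasDerivAt
    (f := fun x => 2 * x * p x * φ x - x ^ 2 * (p x * deriv φ x))
    (a := 0) (b := 1) ?_ (hi1.add hi2)
  · rw [key]
    simp [hbc1]
  · intro x hx
    rw [Set.uIcc_of_le zero_le_one] at hx
    have h := hode x hx
    have hP : HasDerivAt (fun y => p y * deriv φ y)
        (deriv (fun y => p y * deriv φ y) x) x :=
      ((hpd x).mul (hφdd x)).hasDerivAt
    have hF := ((((hasDerivAt_id x).const_mul 2).mul (hpd x).hasDerivAt).mul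
      (hφd x).hasDerivAt).sub ((hasDerivAt_pow 2 x).mul hP)
    refine hF.congr_deriv ?_
    simp
    linear_combination (x ^ 2) * h
end

section
/- With a(x) = p'(x) + (q_c − q(x))x and b(x) = −x, one has ∫₀¹ a(x)φ(x) dx + (−λ + q_c) ∫₀¹ b(x)φ(x) dx = −p(1)φ'(1). (Integration-by-parts identity a_n + (−λ_n + q_c)b_n = −p(1)φ_n'(1) used in Section 5, Dirichlet conditions at both ends.) -/
/-- Integration-by-parts identity
`∫₀¹ a φ + (-λ + q_c) ∫₀¹ b φ = -p(1) φ'(1)` where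
`a(x) = p'(x) + (q_c - q(x)) x` and `b(x) = -x`, for a Sturm–Liouville eigenfunction
`φ` with Dirichlet conditions `φ(0) = 0` and `φ(1) = 0`. -/
theorem ibp_identity_dirichlet_dirichlet
    (p q φ : ℝ → ℝ) (lam qc : ℝ)
    (hp : ContDiff ℝ 1 p) (hq : Continuous q) (hφ : ContDiff ℝ 2 φ)
    (hode : ∀ x ∈ Set.Icc (0 : ℝ) 1,
      -(deriv (fun y => p y * deriv φ y) x) + q x * φ x = lam * φ x)
    (hbc0 : φ 0 = 0) (hbc1 : φ 1 = 0) :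
    (∫ x in (0 : ℝ)..1, (deriv p x + (qc - q x) * x) * φ x)
      + (-lam + qc) * ∫ x in (0 : ℝ)..1, (-x) * φ x
      = -(p 1 * deriv φ 1) := by
  have hpd : ∀ x, HasDerivAt p (deriv p x) x := fun x =>
    (hp.differentiable (by norm_num) x).hasDerivAt
  have hφd : ∀ x, HasDerivAt φ (deriv φ x) x := fun x =>
    (hφ.differentiable (by norm_num) x).hasDerivAt
  have hφ1 : ContDiff ℝ 1 (deriv φ) := by
    have h : ContDiff ℝ (1 + 1) φ := by
      convert hφ using 1
      norm_num
    exact (contDiff_succ_iff_deriv.1 h).2.2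
  have hg : ContDiff ℝ 1 (fun y => p y * deriv φ y) := hp.mul hφ1
  have hgd : ∀ x, HasDerivAt (fun y => p y * deriv φ y)
      (deriv (fun y => p y * deriv φ y) x) x := fun x =>
    (hg.differentiable (by norm_num) x).hasDerivAt
  have hp' : Continuous (deriv p) := hp.continuous_deriv le_rfl
  have hφc : Continuous φ := hφ.continuous
  have h1 : Continuous (fun x => (deriv p x + (qc - q x) * x) * φ x) := by fun_prop
  have h2 : Continuous (fun x : ℝ => (-lam + qc) * ((-x) * φ x)) := by fun_prop
  rw [← intervalIntegral.integral_const_mul,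
    ← intervalIntegral.integral_add (h1.intervalIntegrable _ _) (h2.intervalIntegrable _ _)]
  rw [intervalIntegral.integral_eq_sub_of_hasDerivAt
    (f := fun x => p x * φ x - x * (p x * deriv φ x)) ?_ ?_]
  · simp [hbc0, hbc1]
  · intro x hx
    rw [Set.uIcc_of_le zero_le_one] at hx
    have ho := hode x hx
    refine (((hpd x).mul (hφd x)).sub ((hasDerivAt_id x).mul (hgd x))).congr_deriv ?_
    simp only [id]
    linear_combination x * ho
  · exact (h1.add h2).intervalIntegrable _ _
end

section
/- If φ is not identically zero on [0,1], then with a(x) = 2p(x) + 2x p'(x) + (q_c − q(x))x² and b(x) = −x² one has ∫₀¹ a(x)φ(x) dx + (−λ + q_c) ∫₀¹ b(x)φ(x) dx ≠ 0. (Conclusion of Remark 1: a_n + (−λ_n + q_c)b_n ≠ 0 for every eigenfunction, via Cauchy uniqueness.) -/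
/-- If the Sturm–Liouville eigenfunction `φ` (with `φ'(0) = 0`,
`φ(1) = 0`) is not identically zero on `[0,1]`, then with
`a(x) = 2p(x) + 2x p'(x) + (q_c - q(x)) x²` and `b(x) = -x²` one has
`∫₀¹ a φ + (-λ + q_c) ∫₀¹ b φ ≠ 0`. -/
theorem remark1_nonvanishing
    (p q φ : ℝ → ℝ) (lam qc : ℝ)
    (hp : ContDiff ℝ 1 p) (hppos : ∀ x ∈ Set.Icc (0 : ℝ) 1, 0 < p x)
    (hq : Continuous q) (hφ : ContDiff ℝ 2 φ)
    (hode : ∀ x ∈ Set.Icc (0 : ℝ) 1,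
      -(deriv (fun y => p y * deriv φ y) x) + q x * φ x = lam * φ x)
    (hbc0 : deriv φ 0 = 0) (hbc1 : φ 1 = 0)
    (hne : ¬ ∀ x ∈ Set.Icc (0 : ℝ) 1, φ x = 0) :
    (∫ x in (0 : ℝ)..1, (2 * p x + 2 * x * deriv p x + (qc - q x) * x ^ 2) * φ x)
      + (-lam + qc) * ∫ x in (0 : ℝ)..1, (-x ^ 2) * φ x ≠ 0 := by
  have hpd : ∀ x, HasDerivAt p (deriv p x) x := fun x =>
    (hp.differentiable (by norm_num) x).hasDerivAt
  have hφd : ∀ x, HasDerivAt φ (deriv φ x) x := fun x =>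
    (hφ.differentiable (by norm_num) x).hasDerivAt
  have hφ1 : ContDiff ℝ 1 (deriv φ) := by
    have h2 : ContDiff ℝ (1 + 1) φ := by
      have : (1 + 1 : WithTop ℕ∞) = 2 := by norm_num
      rw [this]; exact hφ
    exact (contDiff_succ_iff_deriv.1 h2).2.2
  have hw : ContDiff ℝ 1 (fun y => p y * deriv φ y) := hp.mul hφ1
  have hwd : ∀ x ∈ Set.Icc (0 : ℝ) 1,
      HasDerivAt (fun y => p y * deriv φ y) ((q x - lam) * φ x) x := by
    intro x hx
    have h := (hw.differentiable (by norm_num) x).hasDerivAt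
    have e := hode x hx
    have e2 : deriv (fun y => p y * deriv φ y) x = (q x - lam) * φ x := by linarith
    rwa [e2] at h
  have hpc : Continuous p := hp.continuous
  have hpc' : Continuous (deriv p) := hp.continuous_deriv le_rfl
  have hφc : Continuous φ := hφ.continuous
  have hF : ∀ x ∈ Set.uIcc (0 : ℝ) 1,
      HasDerivAt (fun x => 2 * x * p x * φ x - x ^ 2 * (p x * deriv φ x))
        ((2 * p x + 2 * x * deriv p x + (qc - q x) * x ^ 2) * φ x
          + (-lam + qc) * ((-x ^ 2) * φ x)) x := by
    intro x hx
    rw [Set.uIcc_of_le zero_le_one] at hx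
    have h1 := ((((hasDerivAt_id x).const_mul 2).mul (hpd x)).mul (hφd x)).sub
      (((hasDerivAt_id x).pow 2).mul (hwd x hx))
    refine h1.congr_deriv ?_
    simp
    ring
  have hI1 : IntervalIntegrable (fun x => (2 * p x + 2 * x * deriv p x + (qc - q x) * x ^ 2) * φ x)
      MeasureTheory.volume 0 1 := by
    apply Continuous.intervalIntegrable; fun_prop
  have hI2 : IntervalIntegrable (fun x => (-lam + qc) * ((-x ^ 2) * φ x))
      MeasureTheory.volume 0 1 := by
    apply Continuous.intervalIntegrable; fun_prop
  intro h0
  rw [← intervalIntegral.integral_const_mul, ← intervalIntegral.integral_add hI1 hI2,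
    intervalIntegral.integral_eq_sub_of_hasDerivAt hF (hI1.add hI2)] at h0
  have hw1 : p 1 * deriv φ 1 = 0 := by
    simp [hbc1] at h0
    simpa using h0
  have hgc : ContinuousOn (fun x => (p x)⁻¹ + (q x - lam)) (Set.Icc (0 : ℝ) 1) := by
    apply ContinuousOn.add
    · exact hpc.continuousOn.inv₀ fun x hx => (hppos x hx).ne'
    · fun_prop
  obtain ⟨K, hK⟩ := isCompact_Icc.exists_bound_of_continuousOn hgc
  have hE : ∀ x ∈ Set.Icc (0 : ℝ) 1,
      HasDerivAt (fun x => (φ x ^ 2 + (p x * deriv φ x) ^ 2) * Real.exp (K * x))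
        ((2 * (φ x * (p x * deriv φ x)) * ((p x)⁻¹ + (q x - lam))
          + K * (φ x ^ 2 + (p x * deriv φ x) ^ 2)) * Real.exp (K * x)) x := by
    intro x hx
    have hne := (hppos x hx).ne'
    have h1 := (((hφd x).pow 2).add ((hwd x hx).pow 2)).mul
      (((hasDerivAt_id x).const_mul K).exp)
    refine h1.congr_deriv ?_
    simp
    field_simp
  have hmono : MonotoneOn (fun x => (φ x ^ 2 + (p x * deriv φ x) ^ 2) * Real.exp (K * x))
      (Set.Icc (0 : ℝ) 1) := by
    apply monotoneOn_of_deriv_nonneg (convex_Icc 0 1)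
    · exact fun x hx => (hE x hx).continuousAt.continuousWithinAt
    · exact fun x hx => (hE x (interior_subset hx)).differentiableAt.differentiableWithinAt
    · intro x hx
      have hx' := interior_subset hx
      rw [(hE x hx').deriv]
      apply mul_nonneg _ (Real.exp_pos _).le
      have hk := abs_le.1 (hK x hx')
      generalize (p x)⁻¹ + (q x - lam) = g at hk
      generalize p x * deriv φ x = w
      generalize φ x = u
      nlinarith [mul_nonneg (sub_nonneg.2 hk.2) (sq_nonneg (u - w)),
        mul_nonneg (neg_le_iff_add_nonneg.1 hk.1) (sq_nonneg (u + w))]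
  apply hne
  intro x hx
  have h := hmono hx (Set.right_mem_Icc.2 zero_le_one) hx.2
  simp only [hw1, hbc1] at h
  have hex := Real.exp_pos (K * x)
  have h3 : φ x ^ 2 + (p x * deriv φ x) ^ 2 ≤ 0 := by
    by_contra hc
    push Not at hc
    have := mul_pos hc hex
    norm_num at h
    linarith
  have : φ x ^ 2 = 0 := by nlinarith [sq_nonneg (φ x), sq_nonneg (p x * deriv φ x)]
  exact pow_eq_zero_iff (two_ne_zero) |>.1 this
end
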